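/- arXiv:2307.16306 — 6 statements merged into one kernel-verified Lean document; each statement's English description precedes it below -/
import Mathlib

section
/- Let P ⊆ ℝ^d be a d-dimensional rational polytope and let λ be a positive rational number. Then λ = μ(P) if and only if F(λP) is nonempty and the dimension of the affine span of F(λP) is at most d−1. In particular F(μ(P)·P) ≠ ∅ and dim F(μ(P)·P) < d. -/
open Set MeasureTheory

noncomputable section

/-- The real vector corresponding to an integer vector. -/
def intVec {d : ℕ} (ν : Fin d → ℤ) : Fin d → ℝ := fun i => (ν i : ℝ)

/-- The standard inner product on `ℝ^d`. -/
def dotR {d : ℕ} (x y : Fin d → ℝ) : ℝ := ∑ i, x i * y i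

/-- `Min_P(ν) = min_{x ∈ P} ⟨x, ν⟩`. -/
def MinP {d : ℕ} (P : Set (Fin d → ℝ)) (ν : Fin d → ℝ) : ℝ :=
  sInf ((fun x => dotR x ν) '' P)

/-- The set of lattice points of `ℝ^d`. -/
def latticePts (d : ℕ) : Set (Fin d → ℝ) := Set.range intVec

/-- The set of rational points of `ℝ^d`. -/
def ratPts (d : ℕ) : Set (Fin d → ℝ) := {x | ∀ i, ∃ q : ℚ, x i = (q : ℝ)}

/-- The Fine interior of `P`. -/
def fineInt {d : ℕ} (P : Set (Fin d → ℝ)) : Set (Fin d → ℝ) :=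
  {x | ∀ ν : Fin d → ℤ, ν ≠ 0 → MinP P (intVec ν) + 1 ≤ dotR x (intVec ν)}

/-- A lattice polytope: the convex hull of a finite set of lattice points. -/
def IsLatticePolytope {d : ℕ} (P : Set (Fin d → ℝ)) : Prop :=
  ∃ A : Finset (Fin d → ℝ), ↑A ⊆ latticePts d ∧ P = convexHull ℝ (A : Set (Fin d → ℝ))

/-- A rational polytope: the convex hull of a finite set of rational points. -/
def IsRatPolytope {d : ℕ} (P : Set (Fin d → ℝ)) : Prop :=
  ∃ A : Finset (Fin d → ℝ), ↑A ⊆ ratPts d ∧ P = convexHull ℝ (A : Set (Fin d → ℝ))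

/-- A subset of `ℝ^d` is full-dimensional if its affine span is everything. -/
def IsFullDim {d : ℕ} (P : Set (Fin d → ℝ)) : Prop := affineSpan ℝ P = ⊤

/-- `P` is F-hollow if its Fine interior is empty. -/
def FHollow {d : ℕ} (P : Set (Fin d → ℝ)) : Prop := fineInt P = ∅

/-- The dilation `λP = {λx : x ∈ P}`. -/
def dilate {d : ℕ} (lam : ℝ) (P : Set (Fin d → ℝ)) : Set (Fin d → ℝ) :=
  (fun x => lam • x) '' P

/-- The minimal multiplier `μ(P)`. -/
def minMult {d : ℕ} (P : Set (Fin d → ℝ)) : ℝ :=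
  sInf {lam : ℝ | 0 < lam ∧ (fineInt (dilate lam P)).Nonempty}

/-- Unimodular equivalence of subsets of `ℝ^d`. -/
def UnimodEquiv {d : ℕ} (P₁ P₂ : Set (Fin d → ℝ)) : Prop :=
  ∃ φ : (Fin d → ℝ) ≃ᵃ[ℝ] (Fin d → ℝ),
    φ '' latticePts d = latticePts d ∧ φ '' P₁ = P₂

/-- An affine map `ℝ^d → ℝ^k` inducing a surjection of lattices. -/
def IsLatticeProj {d k : ℕ} (π : (Fin d → ℝ) →ᵃ[ℝ] (Fin k → ℝ)) : Prop :=
  π '' latticePts d = latticePts k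

/-- A sporadic F-hollow lattice polytope: a full-dimensional F-hollow lattice
polytope admitting no lattice projection onto a lower-dimensional F-hollow
lattice polytope. -/
def IsSporadic {d : ℕ} (P : Set (Fin d → ℝ)) : Prop :=
  IsLatticePolytope P ∧ IsFullDim P ∧ FHollow P ∧
  ¬ ∃ (k : ℕ) (_ : 1 ≤ k) (_ : k ≤ d - 1) (π : (Fin d → ℝ) →ᵃ[ℝ] (Fin k → ℝ)),
      IsLatticeProj π ∧ IsLatticePolytope (π '' P) ∧ IsFullDim (π '' P) ∧
      FHollow (π '' P)

/-- A weakly sporadic F-hollow lattice polytope: a full-dimensional F-hollow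
lattice polytope `P` such that `F(μ(P)·P)` is a single point. -/
def IsWeaklySporadic {d : ℕ} (P : Set (Fin d → ℝ)) : Prop :=
  IsLatticePolytope P ∧ IsFullDim P ∧ FHollow P ∧
  ∃ p : Fin d → ℝ, fineInt (dilate (minMult P) P) = {p}

/-- The support `S_F(P)` of the Fine interior of `P`. -/
def suppF {d : ℕ} (P : Set (Fin d → ℝ)) : Set (Fin d → ℤ) :=
  {ν | MinP (fineInt P) (intVec ν) = MinP P (intVec ν) + 1}

/-- The dimension of the affine span of a set. -/
def aDim {d : ℕ} (S : Set (Fin d → ℝ)) : ℕ :=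
  Module.finrank ℝ (affineSpan ℝ S).direction

/-- Lebesgue volume of a subset of `ℝ^d`, as a real number. -/
def vol {d : ℕ} (S : Set (Fin d → ℝ)) : ℝ := (volume S).toReal

theorem dotR_add_left {d : ℕ} (x y ν : Fin d → ℝ) : dotR (x + y) ν = dotR x ν + dotR y ν := by
  simp [dotR, add_mul, Finset.sum_add_distrib]

theorem dotR_smul_left {d : ℕ} (c : ℝ) (x ν : Fin d → ℝ) : dotR (c • x) ν = c * dotR x ν := by
  simp [dotR, Finset.mul_sum, mul_assoc]

theorem dotR_neg_right {d : ℕ} (x ν : Fin d → ℝ) : dotR x (-ν) = -dotR x ν := by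
  simp [dotR]

theorem continuous_dotR_left {d : ℕ} (ν : Fin d → ℝ) : Continuous fun x => dotR x ν := by
  unfold dotR
  fun_prop

theorem abs_dotR_le {d : ℕ} (x ν : Fin d → ℝ) : |dotR x ν| ≤ ‖x‖ * ∑ i, |ν i| := by
  rw [dotR, Finset.mul_sum]
  refine (Finset.abs_sum_le_sum_abs _ _).trans (Finset.sum_le_sum fun i _ => ?_)
  rw [abs_mul]
  exact mul_le_mul_of_nonneg_right (norm_le_pi_norm x i) (abs_nonneg _)

theorem intVec_neg {d : ℕ} (ν : Fin d → ℤ) : intVec (-ν) = -intVec ν := by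
  ext i
  simp [intVec]

theorem intVec_single {d : ℕ} (i : Fin d) :
    intVec (Pi.single i 1) = (Pi.single i 1 : Fin d → ℝ) := by
  ext j
  by_cases h : j = i
  · subst h
    simp [intVec]
  · simp [intVec, h]

theorem one_le_sum_abs_intVec {d : ℕ} {ν : Fin d → ℤ} (hν : ν ≠ 0) :
    1 ≤ ∑ i, |intVec ν i| := by
  obtain ⟨i, hi⟩ := Function.ne_iff.mp hν
  have h : (1 : ℝ) ≤ |intVec ν i| := by
    have := Int.one_le_abs hi
    simp only [intVec]
    exact_mod_cast this
  exact h.trans (Finset.single_le_sum (f := fun i => |intVec ν i|)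
    (fun _ _ => abs_nonneg _) (Finset.mem_univ i))

/-- A sup-norm ball contains a point minimising `ν` at distance `r` times the `ℓ¹`-norm of `ν`. -/
theorem exists_mem_closedBall_dotR_eq {d : ℕ} (c ν : Fin d → ℝ) {r : ℝ} (hr : 0 ≤ r) :
    ∃ y ∈ Metric.closedBall c r, dotR y ν = dotR c ν - r * ∑ i, |ν i| := by
  refine ⟨fun i => c i - r * SignType.sign (ν i), ?_, ?_⟩
  · rw [Metric.mem_closedBall, dist_pi_le_iff hr]
    intro i
    rw [Real.dist_eq, sub_sub_cancel_left, abs_neg, abs_mul, abs_of_nonneg hr]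
    refine mul_le_of_le_one_right hr ?_
    rcases SignType.sign (ν i) with _ | _ | _ <;> simp
  · rw [dotR, dotR, Finset.mul_sum, ← Finset.sum_sub_distrib]
    refine Finset.sum_congr rfl fun i _ => ?_
    rw [← sign_mul_self (ν i)]
    ring

theorem IsCompact.MinP_le {d : ℕ} {P : Set (Fin d → ℝ)} (hP : IsCompact P)
    (ν : Fin d → ℝ) {x : Fin d → ℝ} (hx : x ∈ P) : MinP P ν ≤ dotR x ν :=
  csInf_le (hP.image (continuous_dotR_left ν)).bddBelow (mem_image_of_mem _ hx)

theorem IsCompact.exists_dotR_eq_MinP {d : ℕ} {P : Set (Fin d → ℝ)} (hP : IsCompact P)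
    (hne : P.Nonempty) (ν : Fin d → ℝ) : ∃ p ∈ P, dotR p ν = MinP P ν :=
  (hP.image (continuous_dotR_left ν)).sInf_mem (hne.image _)

theorem IsCompact.exists_abs_MinP_le {d : ℕ} {P : Set (Fin d → ℝ)} (hP : IsCompact P)
    (hne : P.Nonempty) : ∃ M : ℝ, 0 < M ∧ ∀ ν, |MinP P ν| ≤ M * ∑ i, |ν i| := by
  obtain ⟨M, hM, hPM⟩ := hP.isBounded.exists_pos_norm_le
  refine ⟨M, hM, fun ν => ?_⟩
  obtain ⟨p, hp, h⟩ := hP.exists_dotR_eq_MinP hne ν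
  rw [← h]
  exact (abs_dotR_le p ν).trans
    (mul_le_mul_of_nonneg_right (hPM p hp) (Finset.sum_nonneg fun _ _ => abs_nonneg _))

theorem MinP_dilate {d : ℕ} (P : Set (Fin d → ℝ)) {t : ℝ} (ht : 0 ≤ t) (ν : Fin d → ℝ) :
    MinP (dilate t P) ν = t * MinP P ν := by
  rw [MinP, MinP, ← smul_eq_mul, ← Real.sInf_smul_of_nonneg ht, ← image_smul, dilate,
    image_image, image_image]
  simp only [dotR_smul_left, smul_eq_mul]

theorem mem_fineInt_dilate {d : ℕ} {P : Set (Fin d → ℝ)} {t : ℝ} (ht : 0 ≤ t)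
    {x : Fin d → ℝ} : x ∈ fineInt (dilate t P) ↔
      ∀ ν : Fin d → ℤ, ν ≠ 0 → t * MinP P (intVec ν) + 1 ≤ dotR x (intVec ν) := by
  simp only [fineInt, mem_ofPred_eq, MinP_dilate P ht]

theorem convex_fineInt {d : ℕ} (P : Set (Fin d → ℝ)) : Convex ℝ (fineInt P) := by
  intro x hx y hy a b ha hb hab ν hν
  rw [dotR_add_left, dotR_smul_left, dotR_smul_left]
  have h₁ := mul_le_mul_of_nonneg_left (hx ν hν) ha
  have h₂ := mul_le_mul_of_nonneg_left (hy ν hν) hb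
  obtain rfl : b = 1 - a := by linarith
  linarith

theorem pos_of_mem_fineInt_dilate {d : ℕ} (hd : 0 < d) {P : Set (Fin d → ℝ)} {t : ℝ}
    (ht : 0 ≤ t) {x : Fin d → ℝ} (hx : x ∈ fineInt (dilate t P)) : 0 < t := by
  refine ht.lt_of_ne ?_
  rintro rfl
  have hν : (Pi.single ⟨0, hd⟩ 1 : Fin d → ℤ) ≠ 0 := by simp
  rw [mem_fineInt_dilate le_rfl] at hx
  have h₁ := hx _ hν
  have h₂ := hx _ (neg_ne_zero.mpr hν)
  rw [intVec_neg, dotR_neg_right] at h₂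
  linarith

theorem exists_fineInt_dilate_nonempty {d : ℕ} {P : Set (Fin d → ℝ)} (hP : IsCompact P)
    (hint : (interior P).Nonempty) : ∃ t : ℝ, 0 < t ∧ (fineInt (dilate t P)).Nonempty := by
  obtain ⟨c, hc⟩ := hint
  obtain ⟨r, hr, hball⟩ := Metric.nhds_basis_closedBall.mem_iff.mp (mem_interior_iff_mem_nhds.mp hc)
  refine ⟨r⁻¹, inv_pos.mpr hr, r⁻¹ • c, ?_⟩
  rw [mem_fineInt_dilate (inv_pos.mpr hr).le]
  intro ν hν
  obtain ⟨y, hy, hyν⟩ := exists_mem_closedBall_dotR_eq c (intVec ν) hr.le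
  have h₁ := mul_le_mul_of_nonneg_left
    ((hP.MinP_le (intVec ν) (hball hy)).trans_eq hyν) (inv_pos.mpr hr).le
  rw [mul_sub, inv_mul_cancel_left₀ hr.ne'] at h₁
  rw [dotR_smul_left]
  linarith [one_le_sum_abs_intVec hν]

theorem norm_le_of_mem_fineInt_dilate {d : ℕ} {P : Set (Fin d → ℝ)} {M t : ℝ} (hM : 0 ≤ M)
    (hPM : ∀ ν, |MinP P ν| ≤ M * ∑ i, |ν i|) (ht : 0 ≤ t) {x : Fin d → ℝ}
    (hx : x ∈ fineInt (dilate t P)) : ‖x‖ ≤ t * M := by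
  rw [mem_fineInt_dilate ht] at hx
  refine (pi_norm_le_iff_of_nonneg (mul_nonneg ht hM)).mpr fun i => ?_
  have hν : (Pi.single i 1 : Fin d → ℤ) ≠ 0 := by simp
  have hdot : dotR x (intVec (Pi.single i 1)) = x i := by simp [intVec_single, dotR, Pi.single_apply]
  have hsum : ∑ j, |intVec (Pi.single i 1) j| = 1 := by
    simp [intVec_single, Pi.single_apply, apply_ite abs]
  have h₁ := hx _ hν
  have h₂ := hx _ (neg_ne_zero.mpr hν)
  have h₃ := hPM (intVec (Pi.single i 1))
  have h₄ := hPM (-intVec (Pi.single i 1))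
  rw [intVec_neg, dotR_neg_right] at h₂
  simp only [Pi.neg_apply, abs_neg] at h₄
  rw [hdot] at h₁ h₂
  rw [hsum, mul_one, abs_le] at h₃ h₄
  have h₅ := mul_le_mul_of_nonneg_left h₃.1 ht
  have h₆ := mul_le_mul_of_nonneg_left h₄.1 ht
  rw [Real.norm_eq_abs, abs_le]
  constructor <;> linarith

/-- The infimum defining the minimal multiplier is attained. -/
theorem isLeast_minMult {d : ℕ} (hd : 0 < d) {P : Set (Fin d → ℝ)} (hP : IsCompact P)
    (hint : (interior P).Nonempty) :
    IsLeast {t : ℝ | 0 < t ∧ (fineInt (dilate t P)).Nonempty} (minMult P) := by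
  obtain ⟨M, hM, hPM⟩ := hP.exists_abs_MinP_le (hint.mono interior_subset)
  obtain ⟨T, hT, y, hy⟩ := exists_fineInt_dilate_nonempty hP hint
  let K : Set (ℝ × (Fin d → ℝ)) :=
    Icc 0 T ×ˢ Metric.closedBall 0 (T * M) ∩
      {p | ∀ ν : Fin d → ℤ, ν ≠ 0 → p.1 * MinP P (intVec ν) + 1 ≤ dotR p.2 (intVec ν)}
  have hmem : ∀ t x, 0 ≤ t → t ≤ T → x ∈ fineInt (dilate t P) → (t, x) ∈ K := by
    intro t x ht htT hx
    refine ⟨⟨⟨ht, htT⟩, ?_⟩, (mem_fineInt_dilate ht).mp hx⟩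
    rw [mem_closedBall_zero_iff]
    exact (norm_le_of_mem_fineInt_dilate hM.le hPM ht hx).trans
      (mul_le_mul_of_nonneg_right htT hM.le)
  have hK : IsCompact K := by
    refine (isCompact_Icc.prod (isCompact_closedBall _ _)).inter_right ?_
    simp only [ofPred_forall]
    exact isClosed_iInter fun ν => isClosed_iInter fun _ =>
      isClosed_le (by fun_prop) ((continuous_dotR_left _).comp continuous_snd)
  obtain ⟨⟨t, x⟩, ⟨⟨ht, -⟩, hx⟩, hmin⟩ :=
    hK.exists_isMinOn ⟨(T, y), hmem T y hT.le le_rfl hy⟩ continuous_fst.continuousOn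
  have hx' : x ∈ fineInt (dilate t P) := (mem_fineInt_dilate ht.1).mpr hx
  have hleast : IsLeast {t : ℝ | 0 < t ∧ (fineInt (dilate t P)).Nonempty} t := by
    refine ⟨⟨pos_of_mem_fineInt_dilate hd ht.1 hx', x, hx'⟩, ?_⟩
    rintro s ⟨hs, z, hz⟩
    rcases le_total s T with hsT | hTs
    · exact hmin (hmem s z hs.le hsT hz)
    · exact ht.2.trans hTs
  rwa [minMult, hleast.csInf_eq]

theorem interior_fineInt_dilate_nonempty_of_lt {d : ℕ} {P : Set (Fin d → ℝ)}
    (hP : IsCompact P) (hint : (interior P).Nonempty) {s t : ℝ} (hs : 0 ≤ s) (hst : s < t)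
    (hne : (fineInt (dilate s P)).Nonempty) : (interior (fineInt (dilate t P))).Nonempty := by
  obtain ⟨x, hx⟩ := hne
  rw [mem_fineInt_dilate hs] at hx
  have hsub : (fun p => x + (t - s) • p) '' interior P ⊆ fineInt (dilate t P) := by
    rintro _ ⟨p, hp, rfl⟩
    rw [mem_fineInt_dilate (hs.trans hst.le)]
    intro ν hν
    rw [dotR_add_left, dotR_smul_left]
    have := mul_le_mul_of_nonneg_left (hP.MinP_le (intVec ν) (interior_subset hp))
      (sub_nonneg.mpr hst.le)
    linarith [hx ν hν]
  have hopen : IsOpen ((fun p => x + (t - s) • p) '' interior P) :=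
    ((isOpenMap_add_left x).comp (isOpenMap_smul₀ (sub_ne_zero.mpr hst.ne'))) _ isOpen_interior
  exact (hint.image _).mono (interior_maximal hsub hopen)

theorem exists_lt_fineInt_dilate_nonempty {d : ℕ} {P : Set (Fin d → ℝ)}
    (hP : IsCompact P) (hne : P.Nonempty) {t : ℝ} (ht : 0 < t)
    (hint : (interior (fineInt (dilate t P))).Nonempty) :
    ∃ s : ℝ, 0 < s ∧ s < t ∧ (fineInt (dilate s P)).Nonempty := by
  obtain ⟨M, hM, hPM⟩ := hP.exists_abs_MinP_le hne
  obtain ⟨x, hx⟩ := hint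
  obtain ⟨r, hr, hball⟩ := Metric.nhds_basis_closedBall.mem_iff.mp (mem_interior_iff_mem_nhds.mp hx)
  obtain ⟨ε, hε, hεt⟩ := exists_between (lt_min ht (div_pos hr hM))
  obtain ⟨hεt, hεr⟩ := lt_min_iff.mp hεt
  refine ⟨t - ε, by linarith, by linarith, x, ?_⟩
  rw [mem_fineInt_dilate (by linarith)]
  intro ν hν
  obtain ⟨y, hy, hyν⟩ := exists_mem_closedBall_dotR_eq x (intVec ν) hr.le
  have h₁ := (mem_fineInt_dilate ht.le).mp (hball hy) ν hν
  have h₂ := mul_le_mul_of_nonneg_left (abs_le.mp (hPM (intVec ν))).1 hε.le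
  have h₃ := mul_le_mul_of_nonneg_right ((lt_div_iff₀ hM).mp hεr).le
    (zero_le_one.trans (one_le_sum_abs_intVec hν))
  linarith

theorem aDim_lt_iff {d : ℕ} {S : Set (Fin d → ℝ)} (hS : Convex ℝ S) (hne : S.Nonempty) :
    aDim S < d ↔ ¬ (interior S).Nonempty := by
  have hle : aDim S ≤ d := by
    simpa [aDim] using Submodule.finrank_le (affineSpan ℝ S).direction
  rw [hS.interior_nonempty_iff_affineSpan_eq_top, hle.lt_iff_ne, not_iff_not,
    ← AffineSubspace.direction_eq_top_iff_of_nonempty ((affineSpan_nonempty ℝ).mpr hne)]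
  constructor
  · intro h
    exact Submodule.eq_top_of_finrank_eq (by simpa [aDim] using h)
  · intro h
    rw [aDim, h, finrank_top, Module.finrank_fin_fun]

/-- For a positive rational `λ`, `λ = μ(P)` iff `F(λP)` is nonempty
of dimension at most `d-1`; in particular `F(μ(P)·P) ≠ ∅` and
`dim F(μ(P)·P) < d`. -/
theorem minMult_char (d : ℕ) (hd : 0 < d) (P : Set (Fin d → ℝ))
    (hP : IsRatPolytope P) (hfull : IsFullDim P) (lam : ℚ) (hlam : 0 < lam) :
    (((lam : ℝ) = minMult P) ↔
      ((fineInt (dilate (lam : ℝ) P)).Nonempty ∧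
        aDim (fineInt (dilate (lam : ℝ) P)) ≤ d - 1)) ∧
    (fineInt (dilate (minMult P) P)).Nonempty ∧
    aDim (fineInt (dilate (minMult P) P)) < d := by
  obtain ⟨A, -, hA⟩ := hP
  have hcpt : IsCompact P := hA ▸ A.finite_toSet.isCompact_convexHull ℝ
  have hconv : Convex ℝ P := hA ▸ convex_convexHull ℝ _
  have hint : (interior P).Nonempty := hconv.interior_nonempty_iff_affineSpan_eq_top.mpr hfull
  obtain ⟨⟨hpos, hne⟩, hmin⟩ := isLeast_minMult hd hcpt hint
  have hdim : aDim (fineInt (dilate (minMult P) P)) < d := by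
    rw [aDim_lt_iff (convex_fineInt _) hne]
    intro h
    obtain ⟨s, hs, hlt, hsne⟩ :=
      exists_lt_fineInt_dilate_nonempty hcpt (hint.mono interior_subset) hpos h
    exact hlt.not_ge (hmin ⟨hs, hsne⟩)
  refine ⟨⟨fun h => ?_, fun ⟨hne', hdim'⟩ => ?_⟩, hne, hdim⟩
  · rw [h]
    exact ⟨hne, Nat.le_sub_one_of_lt hdim⟩
  · have hle : minMult P ≤ lam := hmin ⟨Rat.cast_pos.mpr hlam, hne'⟩
    refine (hle.eq_or_lt.resolve_right fun hlt => ?_).symm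
    exact (aDim_lt_iff (convex_fineInt _) hne').mp (by omega)
      (interior_fineInt_dilate_nonempty_of_lt hcpt hint hpos.le hlt hne)
end
end

section
/- Let P ⊆ ℝ^d be a d-dimensional lattice polytope and let π : ℝ^d → ℝ^k (1 ≤ k ≤ d−1) be an affine map with π(ℤ^d) = ℤ^k. Then π(F(P)) ⊆ F(π(P)); in particular, if F(π(P)) = ∅ then F(P) = ∅, i.e., if the lattice projection π(P) is F-hollow then P is F-hollow. -/
open Set MeasureTheory

noncomputable section

/-- The functional `⟨·, ν⟩` composed with a lattice projection is, up to a constant,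
pairing with an integer vector, which is nonzero if `ν` is. -/
theorem IsLatticeProj.exists_dual {d k : ℕ} {π : (Fin d → ℝ) →ᵃ[ℝ] (Fin k → ℝ)}
    (hπ : IsLatticeProj π) {ν : Fin k → ℤ} (hν : ν ≠ 0) :
    ∃ μ : Fin d → ℤ, μ ≠ 0 ∧ ∃ c : ℝ, ∀ x,
      dotR (π x) (intVec ν) = dotR x (intVec μ) + c := by
  have hint : ∀ z : Fin d → ℤ, ∃ w : Fin k → ℤ, intVec w = π (intVec z) := fun z => by
    have h : π (intVec z) ∈ latticePts k := hπ ▸ mem_image_of_mem π ⟨z, rfl⟩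
    exact h
  choose w hw using hint
  have hsingle : ∀ i : Fin d, intVec (Pi.single i 1) = Pi.single i (1 : ℝ) := fun i => by
    ext j
    by_cases h : j = i
    · subst h; simp [intVec]
    · simp [intVec, h]
  have hzero : intVec (0 : Fin d → ℤ) = 0 := by ext; simp [intVec]
  have hkey : ∀ x, dotR (π x) (intVec ν) =
      dotR x (intVec fun i => ∑ j, (w (Pi.single i 1) j - w 0 j) * ν j)
        + dotR (π 0) (intVec ν) := by
    intro x
    have hlin : ∀ i, π.linear (Pi.single i 1) =
        fun j => ((w (Pi.single i 1) j : ℝ) - w 0 j) := fun i => by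
      have h := congrFun (AffineMap.decomp π) (Pi.single i 1)
      ext j
      have h1 := congrFun (hw (Pi.single i 1)) j
      have h0 := congrFun (hw 0) j
      rw [hsingle] at h1
      rw [hzero] at h0
      have h2 := congrFun h j
      simp only [intVec, Pi.add_apply] at h1 h0 h2
      linarith
    have hx : ∀ j, π x j = ∑ i, x i * ((w (Pi.single i 1) j : ℝ) - w 0 j) + π 0 j := by
      intro j
      have h := congrFun (congrFun (AffineMap.decomp π) x) j
      rw [Pi.add_apply, Pi.add_apply, LinearMap.pi_apply_eq_sum_univ π.linear x] at h
      rw [h]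
      congr 1
      rw [Finset.sum_apply]
      refine Finset.sum_congr rfl fun i _ => ?_
      have he : (fun j => if i = j then (1 : ℝ) else 0) = Pi.single i 1 := by
        ext l; simp [Pi.single_apply, eq_comm]
      rw [he, hlin, Pi.smul_apply, smul_eq_mul]
    simp only [dotR, hx, add_mul, Finset.sum_add_distrib, intVec]
    congr 1
    push_cast
    simp only [Finset.sum_mul, Finset.mul_sum]
    rw [Finset.sum_comm]
    simp only [mul_assoc]
  refine ⟨_, fun hμ => hν ?_, _, hkey⟩
  rw [hμ, hzero] at hkey
  have hconst : ∀ z : Fin k → ℤ, dotR (intVec z) (intVec ν) = dotR (π 0) (intVec ν) := by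
    intro z
    obtain ⟨x, -, hx⟩ : intVec z ∈ π '' latticePts d := by
      rw [show π '' latticePts d = latticePts k from hπ]; exact ⟨z, rfl⟩
    rw [← hx, hkey]
    simp [dotR]
  ext i
  have h := (hconst (Pi.single i 1)).trans (hconst 0).symm
  simpa [dotR, intVec, Pi.single_apply] using h

theorem IsLatticePolytope.isCompact {d : ℕ} {P : Set (Fin d → ℝ)}
    (hP : IsLatticePolytope P) : IsCompact P := by
  obtain ⟨A, -, rfl⟩ := hP
  exact A.finite_toSet.isCompact_convexHull (𝕜 := ℝ)

theorem IsLatticePolytope.bddBelow_dotR {d : ℕ} {P : Set (Fin d → ℝ)}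
    (hP : IsLatticePolytope P) (ν : Fin d → ℝ) :
    BddBelow ((fun x => dotR x ν) '' P) :=
  (hP.isCompact.image (by unfold dotR; fun_prop)).bddBelow

theorem IsFullDim.nonempty {d : ℕ} {P : Set (Fin d → ℝ)} (hP : IsFullDim P) :
    P.Nonempty :=
  (affineSpan_nonempty ℝ).1 (by rw [show affineSpan ℝ P = ⊤ from hP]; exact ⟨0, trivial⟩)

/-- A lattice projection maps the Fine interior into the Fine
interior of the image; hence if the projection is F-hollow, so is `P`. -/
theorem fineInt_image_subset (d k : ℕ) (hk1 : 1 ≤ k) (hk2 : k ≤ d - 1)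
    (P : Set (Fin d → ℝ)) (hP : IsLatticePolytope P) (hfull : IsFullDim P)
    (π : (Fin d → ℝ) →ᵃ[ℝ] (Fin k → ℝ)) (hπ : IsLatticeProj π) :
    π '' fineInt P ⊆ fineInt (π '' P) ∧
    (FHollow (π '' P) → FHollow P) := by
  have hsub : π '' fineInt P ⊆ fineInt (π '' P) := by
    rintro _ ⟨x, hx, rfl⟩ ν hν
    obtain ⟨μ, hμ, c, hc⟩ := hπ.exists_dual hν
    have hbdd : BddBelow ((fun y => dotR y (intVec ν)) '' (π '' P)) := by
      obtain ⟨b, hb⟩ := hP.bddBelow_dotR (intVec μ)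
      refine ⟨b + c, ?_⟩
      rintro _ ⟨_, ⟨y, hy, rfl⟩, rfl⟩
      simp only [hc]
      linarith [hb ⟨y, hy, rfl⟩]
    have hmin : MinP (π '' P) (intVec ν) - c ≤ MinP P (intVec μ) := by
      refine le_csInf (hfull.nonempty.image _) ?_
      rintro _ ⟨y, hy, rfl⟩
      have h : MinP (π '' P) (intVec ν) ≤ dotR (π y) (intVec ν) :=
        csInf_le hbdd ⟨π y, mem_image_of_mem π hy, rfl⟩
      rw [hc] at h
      simp only
      linarith
    rw [hc]
    linarith [hx μ hμ]
  refine ⟨hsub, fun h => ?_⟩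
  rw [FHollow] at h ⊢
  rw [h] at hsub
  exact image_eq_empty.1 (subset_empty_iff.1 hsub)
end
end

section
/- For every d-dimensional lattice polytope P ⊆ ℝ^d, the dilated polytope (d+1)P contains a lattice point in its topological interior; consequently F((d+1)P) ≠ ∅ and the minimal multiplier satisfies μ(P) ≤ d+1. -/
open Set MeasureTheory

noncomputable section

theorem dotR_intVec {d : ℕ} (a b : Fin d → ℤ) :
    dotR (intVec a) (intVec b) = ((∑ i, a i * b i : ℤ) : ℝ) := by
  simp [dotR, intVec]

/-- Every interior point of a set lies strictly above any lower bound of a nonzero linear form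
on that set. -/
theorem lt_dotR_of_mem_interior {d : ℕ} {Q : Set (Fin d → ℝ)} {p w : Fin d → ℝ} {m : ℝ}
    (hp : p ∈ interior Q) (hw : w ≠ 0) (hm : ∀ x ∈ Q, m ≤ dotR x w) : m < dotR p w := by
  have hcont : Continuous fun t : ℝ => p - t • w := by fun_prop
  have hev : ∀ᶠ t in nhds (0 : ℝ), p - t • w ∈ Q := by
    have h0 : Q ∈ nhds (p - (0 : ℝ) • w) := by
      simpa using mem_interior_iff_mem_nhds.mp hp
    exact hcont.continuousAt.eventually h0
  obtain ⟨ε, hε, hball⟩ := Metric.eventually_nhds_iff.mp hev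
  have hmem : p - (ε / 2) • w ∈ Q := by
    apply hball
    rw [Real.dist_eq, sub_zero, abs_of_pos (by positivity)]
    linarith
  have hsub : dotR (p - (ε / 2) • w) w = dotR p w - ε / 2 * dotR w w := by
    simp [dotR, sub_mul, Finset.sum_sub_distrib, Finset.mul_sum, mul_assoc]
  have hpos : 0 < dotR w w := by
    obtain ⟨i, hi⟩ := Function.ne_iff.mp hw
    exact Finset.sum_pos' (fun j _ => mul_self_nonneg (w j))
      ⟨i, Finset.mem_univ i, mul_self_pos.mpr hi⟩
  have := hm _ hmem
  have := mul_pos (half_pos hε) hpos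
  linarith

theorem isLatticePolytope_dilate {d : ℕ} {P : Set (Fin d → ℝ)} (hP : IsLatticePolytope P)
    (n : ℕ) : IsLatticePolytope (dilate (n : ℝ) P) := by
  classical
  obtain ⟨A, hA, rfl⟩ := hP
  refine ⟨A.image fun x => (n : ℝ) • x, ?_, ?_⟩
  · intro y hy
    obtain ⟨x, hx, rfl⟩ := Finset.mem_image.mp (Finset.mem_coe.mp hy)
    obtain ⟨a, rfl⟩ := hA hx
    exact ⟨fun i => n * a i, by ext i; simp [intVec]⟩
  · rw [Finset.coe_image]
    exact (LinearMap.lsmul ℝ (Fin d → ℝ) (n : ℝ)).image_convexHull (A : Set (Fin d → ℝ))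

/-- Interior lattice points of a lattice polytope belong to its Fine interior. -/
theorem mem_fineInt_of_mem_interior {d : ℕ} {Q : Set (Fin d → ℝ)} (hQ : IsLatticePolytope Q)
    {p : Fin d → ℝ} (hp : p ∈ interior Q) (hlat : p ∈ latticePts d) : p ∈ fineInt Q := by
  obtain ⟨A, hA, rfl⟩ := hQ
  obtain ⟨z, rfl⟩ := hlat
  intro ν hν
  have hne : A.Nonempty := by
    simpa using convexHull_nonempty_iff.mp ⟨_, interior_subset hp⟩
  obtain ⟨v, hv, hmin⟩ := A.exists_min_image (fun x => dotR x (intVec ν)) hne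
  have hlin : IsLinearMap ℝ fun x : Fin d → ℝ => dotR x (intVec ν) :=
    ⟨fun x y => by simp [dotR, add_mul, Finset.sum_add_distrib],
      fun c x => by simp [dotR, Finset.mul_sum, mul_assoc]⟩
  have hbound : ∀ x ∈ convexHull ℝ (A : Set (Fin d → ℝ)),
      dotR v (intVec ν) ≤ dotR x (intVec ν) := fun x hx =>
    convexHull_min (fun a ha => hmin a ha) (convex_halfSpace_ge hlin _) hx
  have hν' : intVec ν ≠ 0 := fun h => hν <| by
    ext i
    simpa [intVec] using congrFun h i
  have hlt := lt_dotR_of_mem_interior hp hν' hbound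
  have hle : MinP (convexHull ℝ (A : Set (Fin d → ℝ))) (intVec ν) ≤ dotR v (intVec ν) :=
    csInf_le ⟨_, by rintro _ ⟨x, hx, rfl⟩; exact hbound x hx⟩
      ⟨v, subset_convexHull ℝ _ hv, rfl⟩
  obtain ⟨a, rfl⟩ := hA hv
  rw [dotR_intVec, dotR_intVec, Int.cast_lt] at hlt
  have hstep : dotR (intVec a) (intVec ν) + 1 ≤ dotR (intVec z) (intVec ν) := by
    rw [dotR_intVec, dotR_intVec]
    exact_mod_cast hlt
  linarith

open scoped Pointwise in
theorem interior_dilate_inter_latticePts_nonempty {d : ℕ} {P : Set (Fin d → ℝ)}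
    (hP : IsLatticePolytope P) (hfull : IsFullDim P) :
    (interior (dilate ((d : ℝ) + 1) P) ∩ latticePts d).Nonempty := by
  obtain ⟨A, hA, rfl⟩ := hP
  rw [IsFullDim, affineSpan_convexHull] at hfull
  obtain ⟨s, hsA, hspan, hind⟩ := exists_affineIndependent ℝ (Fin d → ℝ) (A : Set (Fin d → ℝ))
  have : Fintype s := (A.finite_toSet.subset hsA).fintype
  let b : AffineBasis s ℝ (Fin d → ℝ) :=
    ⟨((↑) : s → Fin d → ℝ), hind, by rw [Subtype.range_coe, hspan, hfull]⟩
  have hcard : Fintype.card s = d + 1 := by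
    simpa using b.card_eq_finrank_add_one
  have hd : (d : ℝ) + 1 ≠ 0 := by positivity
  have hint : Finset.univ.centroid ℝ b ∈ interior (convexHull ℝ (A : Set (Fin d → ℝ))) := by
    refine interior_mono (convexHull_mono ?_) b.centroid_mem_interior_convexHull
    rintro _ ⟨x, rfl⟩
    exact hsA x.2
  refine ⟨((d : ℝ) + 1) • Finset.univ.centroid ℝ b, ?_, ?_⟩
  · change _ ∈ interior (((d : ℝ) + 1) • convexHull ℝ (A : Set (Fin d → ℝ)))
    rw [interior_smul₀ hd]
    exact Set.smul_mem_smul_set hint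
  · have hne : (Finset.univ : Finset s).Nonempty := by
      rw [← Finset.card_pos, Finset.card_univ, hcard]
      omega
    have hsum : ((d : ℝ) + 1) • Finset.univ.centroid ℝ b = ∑ x : s, (x : Fin d → ℝ) := by
      rw [Finset.centroid_def, Finset.affineCombination_eq_linear_combination _ _ _
        (Finset.univ.sum_centroidWeights_eq_one_of_nonempty ℝ hne)]
      simp only [Finset.centroidWeights_apply, Finset.card_univ, hcard, ← Finset.smul_sum]
      push_cast
      rw [smul_inv_smul₀ hd]
      rfl
    choose f hf using fun x : s => hA (hsA x.2)
    refine ⟨∑ x, f x, ?_⟩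
    rw [hsum]
    ext i
    simp [intVec, ← hf]

/-- `(d+1)P` has an interior lattice point; hence
`F((d+1)P) ≠ ∅` and `μ(P) ≤ d+1`. -/
theorem minMult_le_d_add_one (d : ℕ) (P : Set (Fin d → ℝ))
    (hP : IsLatticePolytope P) (hfull : IsFullDim P) :
    (interior (dilate ((d : ℝ) + 1) P) ∩ latticePts d).Nonempty ∧
    (fineInt (dilate ((d : ℝ) + 1) P)).Nonempty ∧
    minMult P ≤ (d : ℝ) + 1 := by
  have hint := interior_dilate_inter_latticePts_nonempty hP hfull
  have hfine : (fineInt (dilate ((d : ℝ) + 1) P)).Nonempty := by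
    obtain ⟨p, hp, hlat⟩ := hint
    refine ⟨p, mem_fineInt_of_mem_interior ?_ hp hlat⟩
    exact_mod_cast isLatticePolytope_dilate hP (d + 1)
  exact ⟨hint, hfine, csInf_le ⟨0, fun _ h => h.1.le⟩ ⟨by positivity, hfine⟩⟩
end
end

section
/- Let Δ_d ⊆ ℝ^d be the standard d-dimensional lattice simplex, the convex hull of the origin 0 and the standard basis vectors e₁, …, e_d of ℤ^d. Then the minimal multiplier of Δ_d equals d+1, i.e., μ(Δ_d) = d + 1. -/
open Set MeasureTheory

noncomputable section

/-- The standard simplex `conv(0, e₁, …, e_d)`. -/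
def stdSimplexHull (d : ℕ) : Set (Fin d → ℝ) :=
  convexHull ℝ ({0} ∪ Set.range (fun i : Fin d => (Pi.single i 1 : Fin d → ℝ)))

theorem zero_mem_stdSimplexHull (d : ℕ) : (0 : Fin d → ℝ) ∈ stdSimplexHull d :=
  subset_convexHull ℝ _ (Or.inl rfl)

theorem single_mem_stdSimplexHull {d : ℕ} (i : Fin d) :
    (Pi.single i 1 : Fin d → ℝ) ∈ stdSimplexHull d :=
  subset_convexHull ℝ _ (Or.inr ⟨i, rfl⟩)

theorem dotR_smul {d : ℕ} (a : ℝ) (x ν : Fin d → ℝ) : dotR (a • x) ν = a * dotR x ν := by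
  simp [dotR, Finset.mul_sum, mul_assoc]

theorem dotR_single {d : ℕ} (i : Fin d) (ν : Fin d → ℝ) : dotR (Pi.single i 1) ν = ν i := by
  simp [dotR, Pi.single_apply]

theorem le_dotR_of_mem_stdSimplexHull {d : ℕ} {ν : Fin d → ℝ} {c : ℝ} (hc : c ≤ 0)
    (hν : ∀ i, c ≤ ν i) {x : Fin d → ℝ} (hx : x ∈ stdSimplexHull d) : c ≤ dotR x ν := by
  have hconv : Convex ℝ {x : Fin d → ℝ | c ≤ dotR x ν} := by
    refine convex_halfSpace_ge ⟨fun x y => ?_, fun a x => dotR_smul a x ν⟩ c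
    simp [dotR, add_mul, Finset.sum_add_distrib]
  refine convexHull_min ?_ hconv hx
  rintro _ (rfl | ⟨i, rfl⟩)
  · simpa [dotR] using hc
  · simpa [dotR_single] using hν i

theorem mul_le_dotR_of_mem_dilate {d : ℕ} {ν : Fin d → ℝ} {c lam : ℝ} (hlam : 0 ≤ lam)
    (hc : c ≤ 0) (hν : ∀ i, c ≤ ν i) :
    lam * c ∈ lowerBounds ((fun x => dotR x ν) '' dilate lam (stdSimplexHull d)) := by
  rintro _ ⟨_, ⟨x, hx, rfl⟩, rfl⟩
  simp only [dotR_smul]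
  exact mul_le_mul_of_nonneg_left (le_dotR_of_mem_stdSimplexHull hc hν hx) hlam

theorem mul_le_MinP_dilate {d : ℕ} {ν : Fin d → ℝ} {c lam : ℝ} (hlam : 0 ≤ lam)
    (hc : c ≤ 0) (hν : ∀ i, c ≤ ν i) : lam * c ≤ MinP (dilate lam (stdSimplexHull d)) ν :=
  le_csInf (((Set.nonempty_of_mem (zero_mem_stdSimplexHull d)).image _).image _)
    (mul_le_dotR_of_mem_dilate hlam hc hν)

theorem MinP_dilate_le {d : ℕ} (ν : Fin d → ℝ) {lam : ℝ} (hlam : 0 ≤ lam) {y : Fin d → ℝ}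
    (hy : y ∈ stdSimplexHull d) :
    MinP (dilate lam (stdSimplexHull d)) ν ≤ lam * dotR y ν := by
  refine csInf_le ⟨lam * -∑ i, |ν i|, mul_le_dotR_of_mem_dilate hlam ?_ fun i => ?_⟩
    ⟨_, ⟨y, hy, rfl⟩, dotR_smul _ _ _⟩
  · simpa using Finset.sum_nonneg fun i _ => abs_nonneg (ν i)
  · have := Finset.single_le_sum (f := fun i => |ν i|) (fun i _ => abs_nonneg _)
      (Finset.mem_univ i)
    have := neg_abs_le (ν i)
    linarith

theorem one_mem_fineInt (d : ℕ) :
    (1 : Fin d → ℝ) ∈ fineInt (dilate ((d : ℝ) + 1) (stdSimplexHull d)) := by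
  intro ν hν
  have hpos : (0 : ℝ) ≤ (d : ℝ) + 1 := by positivity
  have hsum : dotR 1 (intVec ν) = ((∑ i, ν i : ℤ) : ℝ) := by simp [dotR, intVec]
  rw [hsum]
  by_cases h : ∀ i, 0 ≤ ν i
  · have hmin := MinP_dilate_le (intVec ν) hpos (zero_mem_stdSimplexHull d)
    obtain ⟨i, hi⟩ := Function.ne_iff.mp hν
    have h1 : 0 < ∑ i, ν i :=
      Finset.sum_pos' (fun i _ => h i) ⟨i, Finset.mem_univ i, lt_of_le_of_ne (h i) (Ne.symm hi)⟩
    have h2 : (1 : ℝ) ≤ ((∑ i, ν i : ℤ) : ℝ) := by exact_mod_cast h1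
    have h3 : dotR 0 (intVec ν) = 0 := by simp [dotR]
    rw [h3, mul_zero] at hmin
    linarith
  · push Not at h
    obtain ⟨k, hk⟩ := h
    have : Nonempty (Fin d) := ⟨k⟩
    obtain ⟨j, hj⟩ := Finite.exists_min ν
    have hmin := MinP_dilate_le (intVec ν) hpos (single_mem_stdSimplexHull j)
    rw [dotR_single] at hmin
    have h1 : (d : ℤ) * ν j ≤ ∑ i, ν i := by
      simpa using Finset.card_nsmul_le_sum Finset.univ ν (ν j) fun i _ => hj i
    have h2 : ((d : ℤ) + 1) * ν j + 1 ≤ ∑ i, ν i := by linarith [hj k]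
    have h3 : ((d : ℝ) + 1) * (ν j : ℝ) + 1 ≤ ((∑ i, ν i : ℤ) : ℝ) := by exact_mod_cast h2
    simp only [intVec] at hmin
    linarith

theorem le_of_mem_fineInt_dilate {d : ℕ} (hd : 0 < d) {lam : ℝ} (hlam : 0 < lam)
    {x : Fin d → ℝ} (hx : x ∈ fineInt (dilate lam (stdSimplexHull d))) :
    (d : ℝ) + 1 ≤ lam := by
  have hcoord : ∀ i, 1 ≤ x i := fun i => by
    have h := hx (Pi.single i 1) (by simp)
    have hmin : lam * 0 ≤ MinP (dilate lam (stdSimplexHull d)) (intVec (Pi.single i 1)) :=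
      mul_le_MinP_dilate hlam.le le_rfl fun j => by
        by_cases hji : j = i <;> simp [intVec, hji]
    have hdot : dotR x (intVec (Pi.single i 1)) = x i := by
      simp [dotR, intVec, Pi.single_apply]
    linarith
  have h := hx (-1) fun h0 => by simpa using congrFun h0 ⟨0, hd⟩
  have hmin : lam * (-1) ≤ MinP (dilate lam (stdSimplexHull d)) (intVec (-1)) :=
    mul_le_MinP_dilate hlam.le (by norm_num) fun j => by simp [intVec]
  have hdot : dotR x (intVec (-1)) = -∑ i, x i := by simp [dotR, intVec]
  have hsum : (d : ℝ) ≤ ∑ i, x i := by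
    simpa using Finset.card_nsmul_le_sum Finset.univ x 1 fun i _ => hcoord i
  linarith

/-- The standard `d`-simplex `conv(0, e₁, …, e_d)` has minimal
multiplier `d + 1`. -/
theorem minMult_standard_simplex (d : ℕ) (hd : 0 < d) :
    minMult (convexHull ℝ
      ({0} ∪ Set.range (fun i : Fin d => (Pi.single i 1 : Fin d → ℝ)))) =
      (d : ℝ) + 1 := by
  refine IsLeast.csInf_eq ⟨⟨by positivity, 1, one_mem_fineInt d⟩, ?_⟩
  rintro lam ⟨hlam, x, hx⟩
  exact le_of_mem_fineInt_dilate hd hlam hx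
end
end

section
/- (Hensley) For all positive integers k and d there exists a constant C(k,d), depending only on k and d, such that every d-dimensional lattice polytope P ⊆ ℝ^d containing exactly k lattice points in its topological interior has Lebesgue volume vol(P) ≤ C(k,d). -/
open Set MeasureTheory

noncomputable section

theorem mem_latticePts_iff {d : ℕ} {x : Fin d → ℝ} :
    x ∈ latticePts d ↔ x ∈ Submodule.span ℤ (Set.range (Pi.basisFun ℝ (Fin d))) := by
  rw [Module.Basis.mem_span_iff_repr_mem]
  constructor
  · rintro ⟨ν, rfl⟩ i
    exact ⟨ν i, by simp [intVec]⟩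
  · intro h
    choose ν hν using h
    exact ⟨ν, funext fun i => by simpa [intVec] using hν i⟩

/-- A convex set with exactly `k > 0` interior lattice points cannot contain the lattice
progression `x, x + u, …, x + (k + 1) u` starting at an interior lattice point. -/
theorem add_smul_notMem_of_ncard_eq {d k : ℕ} (hk : 0 < k) {P : Set (Fin d → ℝ)}
    (hP : Convex ℝ P) (hcard : (interior P ∩ latticePts d).ncard = k) {x u : Fin d → ℝ}
    (hx : x ∈ interior P) (hxL : x ∈ latticePts d) (hu : u ∈ latticePts d) (hu0 : u ≠ 0) :
    x + ((k + 1 : ℕ) : ℝ) • u ∉ P := by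
  intro hmem
  have hfin : (interior P ∩ latticePts d).Finite :=
    Set.finite_of_ncard_pos (by omega)
  have hinj : Function.Injective fun j : ℕ => x + (j : ℝ) • u := by
    intro a b hab
    have h := smul_left_injective ℝ hu0 (add_left_cancel hab)
    exact_mod_cast h
  have hsub : (fun j : ℕ => x + (j : ℝ) • u) '' (Finset.range (k + 1) : Set ℕ) ⊆
      interior P ∩ latticePts d := by
    rintro _ ⟨j, hj, rfl⟩
    have hj' : j < k + 1 := by simpa using hj
    have hk' : (0 : ℝ) < ((k + 1 : ℕ) : ℝ) := by positivity
    have hjk : (j : ℝ) < ((k + 1 : ℕ) : ℝ) := by exact_mod_cast hj'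
    refine ⟨?_, ?_⟩
    · have h := hP.combo_interior_self_mem_interior hx hmem
        (a := 1 - j / ((k + 1 : ℕ) : ℝ)) (b := j / ((k + 1 : ℕ) : ℝ))
        (by rw [sub_pos, div_lt_one hk']; exact hjk) (by positivity) (by ring)
      convert h using 1
      rw [smul_add, smul_smul, div_mul_cancel₀ _ hk'.ne', ← add_assoc, ← add_smul]
      simp
    · rw [mem_latticePts_iff] at *
      refine add_mem hxL ?_
      rw [Nat.cast_smul_eq_nsmul]
      exact nsmul_mem hu j
  have h := Set.ncard_le_ncard hsub hfin
  rw [Set.ncard_image_of_injective _ hinj, Set.ncard_coe_finset, Finset.card_range] at h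
  omega

/-- Simultaneous Diophantine approximation, without a bound on the denominator. -/
theorem exists_pos_forall_abs_mul_sub_lt {ι : Type*} [Fintype ι] (b : ι → ℝ) {ε : ℝ}
    (hε : 0 < ε) : ∃ (m : ℕ) (n : ι → ℤ), 0 < m ∧ ∀ i, |m * b i - n i| < ε := by
  have hc : IsCompact (Set.Icc (0 : ι → ℝ) 1) := isCompact_Icc
  obtain ⟨a, -, φ, hφ, hlim⟩ := hc.tendsto_subseq
    (x := fun (m : ℕ) (i : ι) => Int.fract (m * b i))
    (fun m => ⟨fun i => Int.fract_nonneg _, fun i => (Int.fract_lt_one _).le⟩)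
  obtain ⟨N, hN⟩ := Metric.cauchySeq_iff.1 hlim.cauchySeq ε hε
  have hlt : φ N < φ (N + 1) := hφ (Nat.lt_succ_self N)
  refine ⟨φ (N + 1) - φ N, fun i => ⌊(φ (N + 1) : ℝ) * b i⌋ - ⌊(φ N : ℝ) * b i⌋,
    by omega, fun i => ?_⟩
  have h := (dist_le_pi_dist _ _ i).trans_lt (hN (N + 1) (by omega) N le_rfl)
  simp only [Function.comp_apply, Real.dist_eq, Int.fract] at h
  rw [Nat.cast_sub hlt.le]
  push_cast
  refine lt_of_eq_of_lt (congrArg _ ?_) h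
  ring

/-- Near a point `b` of the standard simplex, all points of the open simplex admit a common integer
relation `(m, n)` which may be subtracted `K` times without leaving the simplex. -/
theorem exists_eventually_nonneg {ι : Type*} [Fintype ι] (K : ℕ) {b : ι → ℝ}
    (hb : b ∈ stdSimplex ℝ ι) :
    ∃ (m : ℕ) (n : ι → ℤ), 0 < m ∧ (∀ i, b i = 0 → n i = 0) ∧ ∑ i, n i = m ∧
      ∀ᶠ β : ι → ℝ in nhds b, (∀ i, 0 < β i) → ∀ i, 0 ≤ β i + K * (m * β i - n i) := by
  have hsmall : ∀ᶠ ε : ℝ in nhdsWithin 0 (Set.Ioi 0),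
      (ε < 1 ∧ Fintype.card ι * ε < 1) ∧ ∀ i, 0 < b i → K * ε < b i := by
    refine Filter.Eventually.filter_mono nhdsWithin_le_nhds ?_
    refine ((eventually_lt_nhds zero_lt_one).and ?_).and ?_
    · exact ContinuousAt.eventually_lt (by fun_prop) (by fun_prop) (by simp)
    · refine Filter.eventually_all.2 fun i => ?_
      by_cases hi : 0 < b i
      · filter_upwards [ContinuousAt.eventually_lt (f := fun ε : ℝ => K * ε)
          (g := fun _ => b i) (x₀ := 0) (by fun_prop) (by fun_prop) (by simpa using hi)]
          with ε h _ using h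
      · exact Filter.Eventually.of_forall fun _ h => absurd h hi
  obtain ⟨ε, ⟨⟨hε1, hεc⟩, hεb⟩, hε⟩ := (hsmall.and self_mem_nhdsWithin).exists
  obtain ⟨m, n, hm, hmn⟩ := exists_pos_forall_abs_mul_sub_lt b hε
  have hzero : ∀ i, b i = 0 → n i = 0 := by
    intro i hi
    have h := hmn i
    rw [hi, mul_zero, zero_sub, abs_neg] at h
    have h1 : |(n i : ℝ)| < 1 := h.trans hε1
    rw [← Int.cast_abs] at h1
    exact Int.abs_lt_one_iff.1 (by exact_mod_cast h1)
  refine ⟨m, n, hm, hzero, ?_, ?_⟩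
  · have h : |(m : ℝ) - ∑ i, (n i : ℝ)| < 1 := by
      have h1 : (m : ℝ) - ∑ i, (n i : ℝ) = ∑ i, (m * b i - n i) := by
        rw [Finset.sum_sub_distrib, ← Finset.mul_sum, hb.2, mul_one]
      rw [h1]
      refine (Finset.abs_sum_le_sum_abs _ _).trans_lt (lt_of_le_of_lt ?_ hεc)
      have h2 := Finset.sum_le_sum fun i (_ : i ∈ Finset.univ) => (hmn i).le
      simpa using h2
    have h2 : |(m : ℤ) - ∑ i, n i| < 1 := by exact_mod_cast h
    have h3 := Int.abs_lt_one_iff.1 h2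
    omega
  · suffices h : ∀ i, ∀ᶠ β : ι → ℝ in nhds b, 0 < β i → 0 ≤ β i + K * (m * β i - n i) from
      (Filter.eventually_all.2 h).mono fun β h hβ i => h i (hβ i)
    intro i
    rcases (hb.1 i).eq_or_lt with hi | hi
    · refine Filter.Eventually.of_forall fun β hβ => ?_
      rw [hzero i hi.symm]
      push_cast
      rw [sub_zero]
      positivity
    · have hpos : 0 < b i + K * (m * b i - n i) := by
        have h1 := (abs_lt.1 (hmn i)).1
        have h2 : (K : ℝ) * (-ε) ≤ K * (m * b i - n i) :=
          mul_le_mul_of_nonneg_left h1.le (by positivity)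
        linarith [hεb i hi]
      filter_upwards [ContinuousAt.eventually_lt (f := fun _ : ι → ℝ => (0 : ℝ))
        (g := fun β : ι → ℝ => β i + K * (m * β i - n i)) (x₀ := b)
        (by fun_prop) (by fun_prop) hpos] with β h _ using h.le

theorem exists_pos_forall_lt_of_finite {ι : Type*} [Finite ι] {c : ι → ℝ} (hc : ∀ i, 0 < c i) :
    ∃ c₀ : ℝ, 0 < c₀ ∧ ∀ i, c₀ < c i := by
  have h : ∀ᶠ ε : ℝ in nhdsWithin 0 (Set.Ioi 0), ∀ i, ε < c i :=
    Filter.Eventually.filter_mono nhdsWithin_le_nhds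
      (Filter.eventually_all.2 fun i => eventually_lt_nhds (hc i))
  obtain ⟨ε, hε, hpos⟩ := (h.and self_mem_nhdsWithin).exists
  exact ⟨ε, hpos, hε⟩

theorem exists_pos_relation_fixed (ι : Type*) [Fintype ι] (K : ℕ) :
    ∃ c : ℝ, 0 < c ∧ ∀ β : ι → ℝ, (∀ i, 0 < β i) → ∑ i, β i = 1 → ∀ i₀, β i₀ < c →
      ∃ (m : ℕ) (n : ι → ℤ), 0 < m ∧ n i₀ = 0 ∧ ∑ i, n i = m ∧
        ∀ i, 0 ≤ β i + K * (m * β i - n i) := by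
  suffices h : ∀ i₀ : ι, ∃ c : ℝ, 0 < c ∧ ∀ β : ι → ℝ, (∀ i, 0 < β i) → ∑ i, β i = 1 → β i₀ < c →
      ∃ (m : ℕ) (n : ι → ℤ), 0 < m ∧ n i₀ = 0 ∧ ∑ i, n i = m ∧
        ∀ i, 0 ≤ β i + K * (m * β i - n i) by
    choose c hc h using h
    obtain ⟨c₀, hc₀, hc₀'⟩ := exists_pos_forall_lt_of_finite hc
    exact ⟨c₀, hc₀, fun β hβ hs i₀ hi => h i₀ β hβ hs (hi.trans (hc₀' i₀))⟩
  intro i₀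
  set bad : Set (ι → ℝ) := {β | β ∈ stdSimplex ℝ ι ∧ (∀ i, 0 < β i) ∧
    ¬ ∃ (m : ℕ) (n : ι → ℤ), 0 < m ∧ n i₀ = 0 ∧ ∑ i, n i = m ∧
        ∀ i, 0 ≤ β i + K * (m * β i - n i)} with hbad
  have hsub : closure bad ⊆ stdSimplex ℝ ι :=
    closure_minimal (fun β h => h.1) (isClosed_stdSimplex ℝ ι)
  have hcomp : IsCompact (closure bad) :=
    (isCompact_stdSimplex ℝ ι).of_isClosed_subset isClosed_closure hsub
  have hpos : ∀ b ∈ closure bad, 0 < b i₀ := by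
    intro b hb
    refine ((hsub hb).1 i₀).lt_of_ne fun h0 => ?_
    obtain ⟨m, n, hm, hn, hs, hev⟩ := exists_eventually_nonneg K (hsub hb)
    obtain ⟨β, hβ, hβ'⟩ := ((mem_closure_iff_frequently.1 hb).and_eventually hev).exists
    exact hβ.2.2 ⟨m, n, hm, hn i₀ h0.symm, hs, hβ' hβ.2.1⟩
  have hmin : ∃ c : ℝ, 0 < c ∧ ∀ b ∈ closure bad, c ≤ b i₀ := by
    rcases (closure bad).eq_empty_or_nonempty with he | hne
    · exact ⟨1, one_pos, by simp [he]⟩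
    · obtain ⟨b, hb, hb'⟩ := hcomp.exists_isMinOn hne (f := fun b : ι → ℝ => b i₀)
        (by fun_prop)
      exact ⟨b i₀, hpos b hb, fun b' h => hb' h⟩
  obtain ⟨c, hc, hcb⟩ := hmin
  refine ⟨c, hc, fun β hβ hs hi => ?_⟩
  by_contra hno
  exact absurd (hcb β (subset_closure ⟨⟨fun i => (hβ i).le, hs⟩, hβ, hno⟩)) (not_le.2 hi)

/-- If a positive barycentric coordinate vector has a sufficiently small coordinate `β i₀`, then it
admits an integer relation not involving `i₀` which may be subtracted `K` times. -/
theorem exists_pos_relation (D K : ℕ) :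
    ∃ c : ℝ, 0 < c ∧ ∀ (ι : Type) [Fintype ι], Fintype.card ι ≤ D → ∀ β : ι → ℝ,
      (∀ i, 0 < β i) → ∑ i, β i = 1 → ∀ i₀, β i₀ < c →
      ∃ (m : ℕ) (n : ι → ℤ), 0 < m ∧ n i₀ = 0 ∧ ∑ i, n i = m ∧
        ∀ i, 0 ≤ β i + K * (m * β i - n i) := by
  choose c hc h using fun N : Fin (D + 1) => exists_pos_relation_fixed (Fin N) K
  obtain ⟨c₀, hc₀, hc₀'⟩ := exists_pos_forall_lt_of_finite hc
  refine ⟨c₀, hc₀, fun ι _ hι β hβ hs i₀ hi => ?_⟩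
  let e := Fintype.equivFin ι
  obtain ⟨m, n, hm, hn, hns, hnn⟩ := h ⟨Fintype.card ι, by omega⟩ (β ∘ e.symm)
    (fun i => hβ _) (by rw [← hs]; exact Equiv.sum_comp e.symm β) (e i₀)
    (by simpa using hi.trans (hc₀' _))
  refine ⟨m, n ∘ e, hm, hn, ?_, fun i => by simpa using hnn (e i)⟩
  rw [← hns]
  exact Equiv.sum_comp e n

/-- The coefficient of asymmetry of a lattice polytope about an interior lattice point is bounded
in terms of the dimension and the number of interior lattice points. -/
theorem exists_pos_reflection_mem (k d : ℕ) (hk : 0 < k) :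
    ∃ c : ℝ, 0 < c ∧ c ≤ 1 ∧ ∀ P : Set (Fin d → ℝ), IsLatticePolytope P →
      (interior P ∩ latticePts d).ncard = k → ∀ x ∈ interior P ∩ latticePts d,
        ∀ p ∈ P, x + c • (x - p) ∈ P := by
  obtain ⟨c₀, hc₀, hrel⟩ := exists_pos_relation (d + 2) (k + 1)
  have hc : 0 < min c₀ 1 := lt_min hc₀ one_pos
  refine ⟨min c₀ 1, hc, min_le_right _ _, ?_⟩
  set c := min c₀ 1
  rintro P ⟨A, hAL, hPA⟩ hcard x ⟨hx, hxL⟩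
  have hconv : Convex ℝ P := hPA ▸ convex_convexHull ℝ _
  have hclosed : IsClosed P := by
    rw [hPA]; exact (A.finite_toSet.isCompact_convexHull ℝ).isClosed
  suffices hA : ∀ v ∈ A, x + c • (x - v) ∈ P by
    let f : (Fin d → ℝ) →ᵃ[ℝ] (Fin d → ℝ) := AffineMap.homothety x (-c)
    have hf : ∀ v, f v = x + c • (x - v) := fun v => by
      simp only [f, AffineMap.homothety_apply, vsub_eq_sub, vadd_eq_add]; module
    have hle : P ⊆ f ⁻¹' P := by
      conv_lhs => rw [hPA]
      exact convexHull_min (fun v hv => by simpa [hf] using hA v hv) (hconv.affine_preimage f)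
    exact fun p hp => hf p ▸ hle hp
  intro v hv
  by_contra hnot
  have hvP : v ∈ P := hPA ▸ subset_convexHull ℝ _ hv
  have hcont : Continuous fun t : ℝ => x + t • (x - v) := by fun_prop
  obtain ⟨t, ⟨⟨ht0, htc⟩, htP⟩, htmax⟩ :=
    (isCompact_Icc.inter_right (hclosed.preimage hcont) :
      IsCompact (Set.Icc 0 c ∩ (fun t : ℝ => x + t • (x - v)) ⁻¹' P)).exists_isMaxOn
      ⟨0, ⟨le_rfl, hc.le⟩, by simpa using interior_subset hx⟩ continuousOn_id
  have htc' : t < c := htc.lt_of_ne fun h => hnot (h ▸ htP)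
  have hbeyond : ∀ᶠ s : ℝ in nhdsWithin t (Set.Ioi t), x + s • (x - v) ∉ P := by
    filter_upwards [Ioo_mem_nhdsGT htc'] with s hs hsP
    exact absurd (htmax ⟨⟨ht0.trans hs.1.le, hs.2.le⟩, hsP⟩) (not_le.2 hs.1)
  have htpos : 0 < t := by
    refine ht0.lt_of_ne fun h0 => ?_
    have hev : ∀ᶠ s : ℝ in nhds t, x + s • (x - v) ∈ P :=
      hcont.continuousAt.eventually_mem
        (by rw [← h0]; simpa using mem_interior_iff_mem_nhds.1 hx)
    obtain ⟨s, hs, hs'⟩ := (hbeyond.and (hev.filter_mono nhdsWithin_le_nhds)).exists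
    exact hs hs'
  have htP' : x + t • (x - v) ∈ convexHull ℝ (A : Set (Fin d → ℝ)) := by
    have h : x + t • (x - v) ∈ P := htP
    rwa [hPA] at h
  obtain ⟨ι, _, z, w, hzA, hzind, hw, hw1, hwz⟩ := eq_pos_convex_span_of_mem_convexHull htP'
  have hzP : ∀ i, z i ∈ P := fun i => by
    rw [hPA]; exact subset_convexHull ℝ _ (hzA ⟨i, rfl⟩)
  have hι : Fintype.card (Option ι) ≤ d + 2 := by
    have h := hzind.card_le_finrank_succ
    have h2 := Submodule.finrank_le (vectorSpan ℝ (Set.range z))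
    rw [Module.finrank_fin_fun] at h2
    rw [Fintype.card_option]
    omega
  have h1t : (0 : ℝ) < 1 + t := by linarith
  let β : Option ι → ℝ := fun o => o.elim (t / (1 + t)) fun i => w i / (1 + t)
  have hβ0 : ∀ o, 0 < β o := by
    rintro (_ | i)
    · exact div_pos htpos h1t
    · exact div_pos (hw i) h1t
  have hβ1 : ∑ o, β o = 1 := by
    rw [Fintype.sum_option]
    simp only [β, Option.elim]
    rw [← Finset.sum_div, hw1, ← add_div, add_comm t, div_self h1t.ne']
  have hβc : β none < c₀ :=
    (div_le_self ht0 (by linarith)).trans_lt (htc'.trans_le (min_le_left _ _))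
  obtain ⟨m, n, hm, hn0, hns, hnn⟩ := hrel (Option ι) hι β hβ0 hβ1 none hβc
  rw [Fintype.sum_option, hn0, zero_add] at hns
  have hnsR : ∑ i, (n (some i) : ℝ) = m := by exact_mod_cast hns
  have hmR : (0 : ℝ) < m := by exact_mod_cast hm
  have hxcomb : x = (t / (1 + t)) • v + ∑ i, (w i / (1 + t)) • z i := by
    have h : ∑ i, (w i / (1 + t)) • z i = (1 + t)⁻¹ • ∑ i, w i • z i := by
      rw [Finset.smul_sum]
      exact Finset.sum_congr rfl fun i _ => by rw [smul_smul]; congr 1; ring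
    rw [h, hwz]
    have h2 : x = (1 + t)⁻¹ • ((1 + t) • x) := by rw [smul_smul, inv_mul_cancel₀ h1t.ne', one_smul]
    nth_rw 1 [h2]
    rw [div_eq_inv_mul, ← smul_smul, ← smul_add]
    congr 1
    module
  set u : Fin d → ℝ := (m : ℝ) • x - ∑ i, (n (some i) : ℝ) • z i
  have huL : u ∈ latticePts d := by
    rw [mem_latticePts_iff] at hxL ⊢
    refine sub_mem ?_ (sum_mem fun i _ => ?_)
    · rw [Nat.cast_smul_eq_nsmul]; exact nsmul_mem hxL m
    · rw [Int.cast_smul_eq_zsmul]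
      exact zsmul_mem (mem_latticePts_iff.1 (hAL (hzA ⟨i, rfl⟩))) _
  have hu0 : u ≠ 0 := by
    intro h0
    have hxz : x = ∑ i, (n (some i) / m : ℝ) • z i := by
      have h : (m : ℝ) • x = ∑ i, (n (some i) : ℝ) • z i := sub_eq_zero.1 h0
      have h2 : x = (m : ℝ)⁻¹ • ((m : ℝ) • x) := by
        rw [smul_smul, inv_mul_cancel₀ hmR.ne', one_smul]
      rw [h2, h, Finset.smul_sum]
      exact Finset.sum_congr rfl fun i _ => by rw [smul_smul]; congr 1; ring
    have hev : ∀ᶠ s : ℝ in nhds t, ∀ i, 0 < w i + ((s - t) / t) * (w i - n (some i) / m) := by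
      refine Filter.eventually_all.2 fun i => ?_
      exact ContinuousAt.eventually_lt (by fun_prop) (by fun_prop) (by simpa using hw i)
    obtain ⟨s, hs, hs'⟩ := (hbeyond.and (hev.filter_mono nhdsWithin_le_nhds)).exists
    refine hs ?_
    have hsum : ∑ i, (w i + ((s - t) / t) * (w i - n (some i) / m)) = 1 := by
      rw [Finset.sum_add_distrib, ← Finset.mul_sum, Finset.sum_sub_distrib, hw1,
        ← Finset.sum_div, hnsR, div_self hmR.ne']
      ring
    have hmem := hconv.sum_mem (t := Finset.univ) (fun i _ => (hs' i).le) hsum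
      (fun i _ => hzP i)
    convert hmem using 1
    have h : ∑ i, (w i + ((s - t) / t) * (w i - n (some i) / m)) • z i =
        (x + t • (x - v)) + ((s - t) / t) • ((x + t • (x - v)) - x) := by
      rw [← hwz]
      conv_rhs => rw [hxz]
      rw [← Finset.sum_sub_distrib, Finset.smul_sum, ← Finset.sum_add_distrib]
      exact Finset.sum_congr rfl fun i _ => by module
    rw [h, add_sub_cancel_left, smul_smul, div_mul_cancel₀ _ htpos.ne']
    module
  refine add_smul_notMem_of_ncard_eq hk hconv hcard hx hxL huL hu0 ?_
  let y : Option ι → Fin d → ℝ := fun o => o.elim v z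
  have hsum : ∑ o, (β o + ((k + 1 : ℕ) : ℝ) * (m * β o - n o)) = 1 := by
    rw [Finset.sum_add_distrib, ← Finset.mul_sum, Finset.sum_sub_distrib, ← Finset.mul_sum, hβ1,
      Fintype.sum_option (fun o => (n o : ℝ)), hn0, hnsR]
    simp
  have hmem := hconv.sum_mem (t := Finset.univ) (z := y) (fun o _ => hnn o) hsum
    (by rintro (_ | i) -; exacts [hvP, hzP i])
  convert hmem using 1
  have hxy : x = ∑ o, β o • y o := by rw [Fintype.sum_option]; exact hxcomb
  have huy : u = (m : ℝ) • x - ∑ o, (n o : ℝ) • y o := by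
    rw [Fintype.sum_option (fun o => (n o : ℝ) • y o), hn0, Int.cast_zero, zero_smul, zero_add]
    rfl
  rw [huy, hxy, Finset.smul_sum, ← Finset.sum_sub_distrib, Finset.smul_sum,
    ← Finset.sum_add_distrib]
  exact Finset.sum_congr rfl fun o _ => by module

theorem exists_ne_zero_mem_latticePts {d : ℕ} {s : Set (Fin d → ℝ)}
    (h_symm : ∀ x ∈ s, -x ∈ s) (h_conv : Convex ℝ s) (h : 2 ^ d < volume s) :
    ∃ x ∈ s, x ∈ latticePts d ∧ x ≠ 0 := by
  have hF : volume (ZSpan.fundamentalDomain (Pi.basisFun ℝ (Fin d))) = 1 := by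
    simp [ZSpan.fundamentalDomain_pi_basisFun, volume_pi_pi]
  have : Countable (Submodule.span ℤ (Set.range (Pi.basisFun ℝ (Fin d)))).toAddSubgroup :=
    inferInstanceAs (Countable (Submodule.span ℤ (Set.range (Pi.basisFun ℝ (Fin d)))))
  obtain ⟨x, hx0, hx⟩ := exists_ne_zero_mem_lattice_of_measure_mul_two_pow_lt_measure
    (ZSpan.isAddFundamentalDomain' (Pi.basisFun ℝ (Fin d)) volume) h_symm h_conv
    (by rw [hF, one_mul, Module.finrank_fin_fun]; exact h)
  exact ⟨x, hx, mem_latticePts_iff.2 x.2, fun h0 => hx0 (Subtype.ext h0)⟩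

/-- Hensley: the volume of a `d`-dimensional lattice polytope
with exactly `k ≥ 1` interior lattice points is bounded by a constant
`C(k, d)`. -/
theorem hensley (k d : ℕ) (hk : 0 < k) (hd : 0 < d) :
    ∃ C : ℝ, ∀ P : Set (Fin d → ℝ), IsLatticePolytope P → IsFullDim P →
      (interior P ∩ latticePts d).ncard = k → vol P ≤ C := by
  obtain ⟨c, hc, hc1, hrefl⟩ := exists_pos_reflection_mem k d hk
  set r : ℝ := c / (k + 1 : ℕ) with hr
  have hk1 : (0 : ℝ) < (k + 1 : ℕ) := by positivity
  have hrpos : 0 < r := by positivity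
  refine ⟨2 ^ d / r ^ d, fun P hP _ hcard => ?_⟩
  obtain ⟨x, hx, hxL⟩ : (interior P ∩ latticePts d).Nonempty :=
    Set.nonempty_of_ncard_ne_zero (by omega)
  have hconv : Convex ℝ P := by
    obtain ⟨A, -, rfl⟩ := hP
    exact convex_convexHull ℝ _
  by_contra! hvol
  have hvol_top : volume P ≠ ⊤ := fun h => by
    rw [vol, h, ENNReal.toReal_top] at hvol
    exact absurd hvol (not_lt.2 (by positivity))
  let s : Set (Fin d → ℝ) :=
    {u | x + ((k + 1 : ℕ) : ℝ) • u ∈ P ∧ x + ((k + 1 : ℕ) : ℝ) • (-u) ∈ P}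
  have hs_symm : ∀ u ∈ s, -u ∈ s := fun u hu => ⟨hu.2, by rw [neg_neg]; exact hu.1⟩
  have hs_conv : Convex ℝ s := by
    intro u hu u' hu' a b ha hb hab
    refine ⟨?_, ?_⟩
    · convert hconv hu.1 hu'.1 ha hb hab using 1
      nth_rw 1 [← one_smul ℝ x, ← hab]
      module
    · convert hconv hu.2 hu'.2 ha hb hab using 1
      nth_rw 1 [← one_smul ℝ x, ← hab]
      module
  have hsub : (fun y => r • y) '' ((fun y => x + y) ⁻¹' P) ⊆ s := by
    rintro _ ⟨y, hy, rfl⟩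
    have hr' : ((k + 1 : ℕ) : ℝ) * r = c := by rw [hr]; field_simp
    refine ⟨?_, ?_⟩
    · have h := hconv (interior_subset hx) hy (sub_nonneg.2 hc1) hc.le (sub_add_cancel 1 c)
      convert h using 1
      simp only [smul_smul, hr']
      module
    · have h := hrefl P hP hcard x ⟨hx, hxL⟩ _ hy
      convert h using 1
      simp only [smul_neg, smul_smul, hr']
      module
  have hs_vol : 2 ^ d < volume s := by
    refine lt_of_lt_of_le ?_ (measure_mono hsub)
    rw [Set.image_smul, Measure.addHaar_smul, measure_preimage_add, Module.finrank_fin_fun,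
      abs_of_pos (pow_pos hrpos d), ← ENNReal.ofReal_toReal hvol_top,
      ← ENNReal.ofReal_mul (by positivity)]
    have h : (2 : ENNReal) ^ d = ENNReal.ofReal (2 ^ d) := by
      rw [ENNReal.ofReal_pow (by norm_num)]; simp
    rw [h]
    have h2 : (2 : ℝ) ^ d < r ^ d * (volume P).toReal := by
      rw [mul_comm]; exact (div_lt_iff₀ (pow_pos hrpos d)).1 hvol
    exact (ENNReal.ofReal_lt_ofReal_iff (lt_trans (by positivity) h2)).2 h2
  obtain ⟨u, hu, huL, hu0⟩ := exists_ne_zero_mem_latticePts hs_symm hs_conv hs_vol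
  exact add_smul_notMem_of_ncard_eq hk hconv hcard hx hxL huL hu0 hu.1
end
end

section
/- (Lagarias–Ziegler) Let V > 0 and let P ⊆ ℝ^d be a d-dimensional lattice polytope with Lebesgue volume vol(P) ≤ V. Then P is unimodular equivalent to a lattice polytope contained in the cube {x ∈ ℝ^d : 0 ≤ x_i ≤ d·d!·V for i = 1, …, d}. Consequently, a family of d-dimensional lattice polytopes contains only finitely many unimodular equivalence classes if and only if the volumes of its members are bounded above by some constant. -/
open Set MeasureTheory

noncomputable section

open Matrix

/-- The square matrix whose rows are the homogeneous coordinates `(1, f i)` of the points `f i`. -/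
def homogMatrix {R : Type*} [CommRing R] {d : ℕ} (f : Fin (d + 1) → Fin d → R) :
    Matrix (Fin (d + 1)) (Fin (d + 1)) R :=
  Matrix.of fun i => Fin.cons 1 (f i)

/-- The determinant of the block matrix with first column `(1, 0, …, 0)`. -/
theorem det_of_cons_one_zero {R : Type*} [CommRing R] {d : ℕ} (v : Fin d → R)
    (N : Matrix (Fin d) (Fin d) R) :
    (Matrix.of (Fin.cons (Fin.cons 1 v) fun k => Fin.cons 0 (N k)) :
      Matrix (Fin (d + 1)) (Fin (d + 1)) R).det = N.det := by
  rw [Matrix.det_succ_column_zero, Fin.sum_univ_succ]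
  simp only [Matrix.of_apply, Fin.cons_zero, Fin.cons_succ, mul_zero, zero_mul,
    Finset.sum_const_zero, add_zero, Fin.val_zero, pow_zero, one_mul]
  congr 1

theorem det_homogMatrix_eq_det_sub_zero {R : Type*} [CommRing R] {d : ℕ}
    (f : Fin (d + 1) → Fin d → R) :
    (homogMatrix f).det = (Matrix.of fun k : Fin d => f k.succ - f 0).det := by
  rw [← det_of_cons_one_zero (f 0)]
  refine Matrix.det_eq_of_forall_row_eq_smul_add_const (Fin.cons 0 fun _ => 1) 0 rfl ?_
  intro i j
  refine Fin.cases ?_ (fun i => ?_) i <;> refine Fin.cases ?_ (fun j => ?_) j <;>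
    simp [homogMatrix]

theorem det_homogMatrix_eq_det_sub_pred {R : Type*} [CommRing R] {d : ℕ}
    (f : Fin (d + 1) → Fin d → R) :
    (homogMatrix f).det = (Matrix.of fun k : Fin d => f k.succ - f k.castSucc).det := by
  rw [← det_of_cons_one_zero (f 0)]
  refine Matrix.det_eq_of_forall_row_eq_smul_add_pred (fun _ => 1) ?_ ?_
  · intro j; rfl
  · intro i j
    refine Fin.cases ?_ (fun j => ?_) j <;> simp [homogMatrix]

theorem det_homogMatrix_intVec {d : ℕ} (f : Fin (d + 1) → Fin d → ℤ) :
    (homogMatrix fun i => intVec (f i)).det = ((homogMatrix f).det : ℝ) := by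
  rw [← eq_intCast (Int.castRingHom ℝ), RingHom.map_det]
  congr 1
  ext i j
  refine Fin.cases ?_ (fun j => ?_) j <;> simp [homogMatrix, intVec]

/-- A lattice set affinely spanning `ℝ^d` contains the vertices of a nondegenerate simplex. -/
theorem exists_det_homogMatrix_ne_zero {d : ℕ} (B : Set (Fin d → ℤ))
    (hB : affineSpan ℝ (intVec '' B) = ⊤) :
    ∃ f : Fin (d + 1) → Fin d → ℤ, (∀ i, f i ∈ B) ∧ (homogMatrix f).det ≠ 0 := by
  obtain ⟨t, hts, hspan, hind⟩ := exists_affineIndependent ℝ (Fin d → ℝ) (intVec '' B)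
  rw [hB] at hspan
  have : Finite t := finite_of_fin_dim_affineIndependent ℝ hind
  have : Fintype t := Fintype.ofFinite t
  have hcard : Fintype.card t = d + 1 := by
    have := (hind.affineSpan_eq_top_iff_card_eq_finrank_add_one).1 (by simpa using hspan)
    simpa using this
  let e : Fin (d + 1) ≃ t := (finCongr hcard.symm).trans (Fintype.equivFin t).symm
  choose f hfB hf using fun i => hts (e i).2
  refine ⟨f, hfB, ?_⟩
  have hind' : AffineIndependent ℝ fun i => intVec (f i) := by
    have hcomp := hind.comp_embedding e.toEmbedding
    have heq : (fun i => intVec (f i)) = (fun x : t => (x : Fin d → ℝ)) ∘ e.toEmbedding :=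
      funext hf
    rwa [heq]
  rw [affineIndependent_iff_linearIndependent_vsub ℝ _ 0] at hind'
  have hlin := hind'.comp (fun k : Fin d => ⟨k.succ, Fin.succ_ne_zero k⟩)
    (fun a b h => by simpa using h)
  have hunit := (Matrix.linearIndependent_rows_iff_isUnit
    (A := Matrix.of fun k : Fin d => intVec (f k.succ) - intVec (f 0))).1 hlin
  rw [Matrix.isUnit_iff_isUnit_det, ← det_homogMatrix_eq_det_sub_zero (fun i => intVec (f i)),
    det_homogMatrix_intVec] at hunit
  exact_mod_cast hunit.ne_zero

/-- The simplex of antitone sequences in the unit cube. -/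
def antitoneSimplex (d : ℕ) : Set (Fin d → ℝ) :=
  {x | Antitone x ∧ ∀ i, 0 ≤ x i ∧ x i ≤ 1}

theorem one_le_factorial_mul_volume_antitoneSimplex (d : ℕ) :
    1 ≤ (d.factorial : ENNReal) * volume (antitoneSimplex d) := by
  let R (σ : Equiv.Perm (Fin d)) := MeasurableEquiv.piCongrLeft (fun _ : Fin d => ℝ) σ
  have hR (σ : Equiv.Perm (Fin d)) (x : Fin d → ℝ) (i : Fin d) : R σ x (σ i) = x i :=
    MeasurableEquiv.piCongrLeft_apply_apply ..
  have hcover : Icc (0 : Fin d → ℝ) 1 ⊆ ⋃ σ, R σ ⁻¹' antitoneSimplex d := by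
    intro x hx
    let σ := (Tuple.sort fun i => -x i)
    have hσ : Monotone fun i => -x (σ i) := Tuple.monotone_sort fun i => -x i
    have hval (i : Fin d) : R σ.symm x i = x (σ i) := by
      simpa using hR σ.symm x (σ i)
    refine mem_iUnion.2 ⟨σ.symm, ?_, fun i => ?_⟩
    · intro i j hij
      rw [hval, hval]
      simpa using hσ hij
    · rw [hval]
      exact ⟨hx.1 _, hx.2 _⟩
  calc (1 : ENNReal) = volume (Icc (0 : Fin d → ℝ) 1) := by simp [Real.volume_Icc_pi]
    _ ≤ ∑ σ, volume (R σ ⁻¹' antitoneSimplex d) :=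
        (measure_mono hcover).trans (measure_iUnion_fintype_le _ _)
    _ = ∑ _σ : Equiv.Perm (Fin d), volume (antitoneSimplex d) :=
        Finset.sum_congr rfl fun σ _ =>
          (volume_measurePreserving_piCongrLeft (fun _ : Fin d => ℝ) σ).measure_preimage_equiv _
    _ = _ := by simp [Fintype.card_perm]

theorem edge_sum_mem_convexHull {d : ℕ} (f : Fin (d + 1) → Fin d → ℝ) {x : Fin d → ℝ}
    (hx : x ∈ antitoneSimplex d) :
    f 0 + ∑ k : Fin d, x k • (f k.succ - f k.castSucc) ∈ convexHull ℝ (range f) := by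
  obtain ⟨hanti, h01⟩ := hx
  let w : Fin (d + 1) → ℝ :=
    fun i => (Fin.cons 1 x : Fin (d + 1) → ℝ) i - (Fin.snoc x 0 : Fin (d + 1) → ℝ) i
  have hone (i : Fin (d + 1)) : (Fin.snoc x 0 : Fin (d + 1) → ℝ) i ≤ 1 := by
    refine Fin.lastCases ?_ (fun j => ?_) i
    · simp
    · simpa using (h01 j).2
  have hw0 : ∀ i, 0 ≤ w i := by
    intro i
    refine Fin.cases ?_ (fun k => ?_) i
    · simpa [w] using hone 0
    · rcases Fin.eq_castSucc_or_eq_last k.succ with ⟨j, hj⟩ | hl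
      · have hkj : k ≤ j := by
          have := congrArg Fin.val hj
          simp only [Fin.val_succ, Fin.val_castSucc] at this
          exact Fin.le_def.2 (by omega)
        simp only [w, Fin.cons_succ]
        rw [hj, Fin.snoc_castSucc]
        exact sub_nonneg.2 (hanti hkj)
      · simp only [w, Fin.cons_succ]
        rw [hl, Fin.snoc_last]
        simpa using (h01 k).1
  have hw1 : ∑ i, w i = 1 := by
    simp only [w, Finset.sum_sub_distrib]
    rw [Fin.sum_univ_succ, Fin.sum_univ_castSucc]
    simp
  have hsum : ∑ i, w i • f i = f 0 + ∑ k : Fin d, x k • (f k.succ - f k.castSucc) := by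
    simp only [w, sub_smul, smul_sub, Finset.sum_sub_distrib]
    rw [Fin.sum_univ_succ, Fin.sum_univ_castSucc (fun i => (Fin.snoc x 0 : Fin (d + 1) → ℝ) i • f i)]
    simp [add_sub_assoc]
  rw [← hsum]
  exact (convex_convexHull ℝ _).sum_mem (fun i _ => hw0 i) hw1
    fun i _ => subset_convexHull ℝ _ (mem_range_self i)

/-- A simplex with vertices `f i` has volume at least `|det| / d!`. -/
theorem abs_det_homogMatrix_le_factorial_mul_volume {d : ℕ} (f : Fin (d + 1) → Fin d → ℝ) :
    ENNReal.ofReal |(homogMatrix f).det| ≤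
      (d.factorial : ENNReal) * volume (convexHull ℝ (range f)) := by
  let N : Matrix (Fin d) (Fin d) ℝ := Matrix.of fun k => f k.succ - f k.castSucc
  have hsub : (fun y => f 0 + y) '' (Matrix.toLin' Nᵀ '' antitoneSimplex d) ⊆
      convexHull ℝ (range f) := by
    rintro _ ⟨_, ⟨x, hx, rfl⟩, rfl⟩
    convert edge_sum_mem_convexHull f hx using 2
    ext j
    simp [N, Matrix.toLin'_apply, Matrix.mulVec, dotProduct, mul_comm]
  have hvol : volume ((fun y => f 0 + y) '' (Matrix.toLin' Nᵀ '' antitoneSimplex d)) =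
      ENNReal.ofReal |(homogMatrix f).det| * volume (antitoneSimplex d) := by
    rw [image_add_left, measure_preimage_add, Measure.addHaar_image_linearMap,
      LinearMap.det_toLin', Matrix.det_transpose, det_homogMatrix_eq_det_sub_pred]
  calc ENNReal.ofReal |(homogMatrix f).det|
      ≤ ENNReal.ofReal |(homogMatrix f).det| *
          ((d.factorial : ENNReal) * volume (antitoneSimplex d)) :=
        le_mul_of_one_le_right (by simp) (one_le_factorial_mul_volume_antitoneSimplex d)
    _ = (d.factorial : ENNReal) *
          (ENNReal.ofReal |(homogMatrix f).det| * volume (antitoneSimplex d)) := by ring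
    _ ≤ _ := by
        rw [← hvol]
        gcongr

/-- A unimodular matrix brings any integer vector to a nonnegative multiple of `(1, 0, …, 0)`. -/
theorem exists_unimodular_mulVec_eq_zero {n : ℕ} (m : Fin (n + 1) → ℤ) :
    ∃ U : Matrix (Fin (n + 1)) (Fin (n + 1)) ℤ, IsUnit U.det ∧ 0 ≤ (U *ᵥ m) 0 ∧
      ∀ i : Fin n, (U *ᵥ m) i.succ = 0 := by
  let S : Set (Matrix (Fin (n + 1)) (Fin (n + 1)) ℤ) := {U | IsUnit U.det}
  let size (U : Matrix (Fin (n + 1)) (Fin (n + 1)) ℤ) : ℕ := ∑ i, ((U *ᵥ m) i).natAbs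
  have hS : S.Nonempty := ⟨1, by simp [S]⟩
  obtain ⟨U, hU, hmin⟩ : ∃ U ∈ S, ∀ W ∈ S, size U ≤ size W :=
    ⟨Function.argminOn size S hS, Function.argminOn_mem size S hS,
      fun W hW => Function.argminOn_le size S hW⟩
  have hsingle : ∀ i j, i ≠ j → (U *ᵥ m) i ≠ 0 →
      ((U *ᵥ m) i).natAbs ≤ ((U *ᵥ m) j).natAbs → False := by
    intro i j hij hi hle
    let W := Matrix.transvection j i (-((U *ᵥ m) j / (U *ᵥ m) i)) * U
    have hW : W ∈ S := by
      simp only [S, W, mem_ofPred_eq, Matrix.det_mul, Matrix.det_transvection_of_ne _ _ hij.symm,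
        one_mul]
      exact hU
    have hWm : W *ᵥ m = Function.update (U *ᵥ m) j ((U *ᵥ m) j % (U *ᵥ m) i) := by
      rw [← Matrix.mulVec_mulVec, Matrix.transvection, Matrix.add_mulVec, Matrix.one_mulVec,
        Matrix.single_mulVec]
      ext k
      by_cases hk : k = j
      · subst hk
        simp [Int.emod_def]
        ring
      · simp [hk]
    have hlt : ((U *ᵥ m) j % (U *ᵥ m) i).natAbs < ((U *ᵥ m) j).natAbs := by
      refine lt_of_lt_of_le ?_ hle
      rw [← Int.ofNat_lt, Int.natCast_natAbs, Int.natCast_natAbs, abs_of_nonneg (Int.emod_nonneg _ hi)]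
      exact Int.emod_lt_abs _ hi
    refine (hmin W hW).not_gt ?_
    refine Finset.sum_lt_sum (fun k _ => ?_) ⟨j, Finset.mem_univ j, ?_⟩
    · rw [hWm]
      by_cases hk : k = j
      · subst hk
        simpa using hlt.le
      · simp [hk]
    · rw [hWm]
      simpa using hlt
  obtain ⟨i₀, hi₀⟩ : ∃ i₀, ∀ k, k ≠ i₀ → (U *ᵥ m) k = 0 := by
    by_cases h : ∃ i, (U *ᵥ m) i ≠ 0
    · obtain ⟨i, hi⟩ := h
      refine ⟨i, fun k hk => by_contra fun hk0 => ?_⟩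
      rcases le_total ((U *ᵥ m) i).natAbs ((U *ᵥ m) k).natAbs with hle | hle
      · exact hsingle i k hk.symm hi hle
      · exact hsingle k i hk hk0 hle
    · push Not at h
      exact ⟨0, fun k _ => h k⟩
  let σ := Equiv.swap 0 i₀
  let P := U.submatrix σ id
  have hP : IsUnit P.det := by
    rw [Matrix.det_permute]
    exact (((Equiv.Perm.sign σ).isUnit).map (Int.castRingHom ℤ)).mul hU
  have hPm (i : Fin (n + 1)) : (P *ᵥ m) i = (U *ᵥ m) (σ i) := rfl
  have hzero (i : Fin n) : (P *ᵥ m) i.succ = 0 := by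
    rw [hPm]
    refine hi₀ _ fun h => Fin.succ_ne_zero i ?_
    rw [Equiv.swap_apply_eq_iff, Equiv.swap_apply_right] at h
    exact h
  rcases le_total 0 ((P *ᵥ m) 0) with h0 | h0
  · exact ⟨P, hP, h0, hzero⟩
  · refine ⟨-P, ?_, ?_, fun i => ?_⟩
    · rw [Matrix.det_neg]
      exact (isUnit_one.neg.pow _).mul hP
    · simpa [Matrix.neg_mulVec] using h0
    · simpa [Matrix.neg_mulVec] using hzero i

/-- A weak form of the Hermite normal form: an integer matrix with nonzero determinant can be
brought by a unimodular matrix to one whose entries lie between `0` and `|det|`. -/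
theorem exists_unimodular_mul_entries_le {d : ℕ} (M : Matrix (Fin d) (Fin d) ℤ)
    (hM : M.det ≠ 0) :
    ∃ U : Matrix (Fin d) (Fin d) ℤ, IsUnit U.det ∧
      ∀ i j, 0 ≤ (U * M) i j ∧ (U * M) i j ≤ |M.det| := by
  induction d with
  | zero => exact ⟨1, by simp, fun i => i.elim0⟩
  | succ d ih =>
    obtain ⟨U₁, hU₁, hpos, hzero⟩ := exists_unimodular_mulVec_eq_zero (M.col 0)
    set A := U₁ * M with hA
    have hg : 0 ≤ A 0 0 := hpos
    have hA0 (i : Fin d) : A i.succ 0 = 0 := hzero i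
    let M' := A.submatrix Fin.succ Fin.succ
    have hdetA : A.det = A 0 0 * M'.det := by
      rw [Matrix.det_succ_column_zero, Fin.sum_univ_succ]
      simp only [hA0, mul_zero, zero_mul, Finset.sum_const_zero, add_zero, Fin.val_zero, pow_zero,
        one_mul]
      rfl
    have habs : |M.det| = A 0 0 * |M'.det| := by
      rw [← abs_of_nonneg hg, ← abs_mul, ← hdetA, hA, Matrix.det_mul, abs_mul,
        Int.isUnit_iff_abs_eq.1 hU₁, one_mul]
    have hne : A 0 0 * |M'.det| ≠ 0 := habs ▸ abs_ne_zero.2 hM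
    have hM' : M'.det ≠ 0 := fun h => hne (by simp [h])
    have hgpos : 1 ≤ A 0 0 := lt_of_le_of_ne hg fun h => hne (by simp [← h])
    have hD' : 1 ≤ |M'.det| := abs_pos.2 hM'
    have hle : |M'.det| ≤ |M.det| := by rw [habs]; nlinarith
    obtain ⟨U₂, hU₂, hent⟩ := ih M' hM'
    let q : Fin d → ℤ := fun j => A 0 j.succ / M'.det
    let c : Fin d → ℤ := -(q ᵥ* M'.adjugate)
    have hc (j : Fin d) : ∑ k, c k * A k.succ j.succ = -(M'.det * q j) := by
      have h : c ᵥ* M' = -(M'.det • q) := by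
        rw [Matrix.neg_vecMul, Matrix.vecMul_vecMul, Matrix.adjugate_mul, Matrix.vecMul_smul,
          Matrix.vecMul_one]
      exact congrFun h j
    let U₃ : Matrix (Fin (d + 1)) (Fin (d + 1)) ℤ :=
      Matrix.of (Fin.cons (Fin.cons 1 c) fun k => Fin.cons 0 (U₂ k))
    refine ⟨U₃ * U₁, ?_, ?_⟩
    · rw [Matrix.det_mul, det_of_cons_one_zero]
      exact hU₂.mul hU₁
    rw [Matrix.mul_assoc, ← hA]
    have hrow0 (j : Fin (d + 1)) : (U₃ * A) 0 j = A 0 j + ∑ k, c k * A k.succ j := by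
      simp [U₃, Matrix.mul_apply, Fin.sum_univ_succ]
    have hrow (i : Fin d) (j : Fin (d + 1)) : (U₃ * A) i.succ j = ∑ k, U₂ i k * A k.succ j := by
      simp [U₃, Matrix.mul_apply, Fin.sum_univ_succ]
    intro i j
    refine Fin.cases ?_ (fun i => ?_) i <;> refine Fin.cases ?_ (fun j => ?_) j
    · rw [hrow0]
      simp only [hA0, mul_zero, Finset.sum_const_zero, add_zero]
      exact ⟨hg, by rw [habs]; nlinarith⟩
    · rw [hrow0, hc, ← sub_eq_add_neg, ← Int.emod_def]
      exact ⟨Int.emod_nonneg _ hM', (Int.emod_lt_abs _ hM').le.trans hle⟩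
    · rw [hrow]
      simp only [hA0, mul_zero, Finset.sum_const_zero]
      exact ⟨le_rfl, abs_nonneg _⟩
    · rw [hrow]
      exact ⟨(hent i j).1, (hent i j).2.trans hle⟩

theorem intVec_mem_latticePts {d : ℕ} (b : Fin d → ℤ) : intVec b ∈ latticePts d :=
  mem_range_self b

theorem intVec_injective (d : ℕ) : Function.Injective (intVec : (Fin d → ℤ) → Fin d → ℝ) :=
  fun _ _ h => funext fun i => Int.cast_injective (congrFun h i)

theorem map_mulVec_intVec {d : ℕ} (U : Matrix (Fin d) (Fin d) ℤ) (b : Fin d → ℤ) :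
    U.map (Int.castRingHom ℝ) *ᵥ intVec b = intVec (U *ᵥ b) := by
  ext i
  exact (RingHom.map_mulVec (Int.castRingHom ℝ) U b i).symm

/-- A unimodular integer matrix and an integer translation define a lattice-preserving affine
equivalence of `ℝ^d`. -/
theorem exists_affineEquiv_intVec {d : ℕ} (U : Matrix (Fin d) (Fin d) ℤ) (hU : IsUnit U.det)
    (t : Fin d → ℤ) :
    ∃ φ : (Fin d → ℝ) ≃ᵃ[ℝ] (Fin d → ℝ), φ '' latticePts d = latticePts d ∧
      ∀ b, φ (intVec b) = intVec (U *ᵥ b + t) := by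
  have hadd (a b : Fin d → ℤ) : intVec (a + b) = intVec a + intVec b := by
    ext i; simp [intVec]
  let c := Int.castRingHom ℝ
  have h1 : U.map c * U⁻¹.map c = 1 := by
    rw [← Matrix.map_mul, Matrix.mul_nonsing_inv U hU]; simp [c]
  have h2 : U⁻¹.map c * U.map c = 1 := by
    rw [← Matrix.map_mul, Matrix.nonsing_inv_mul U hU]; simp [c]
  let L : (Fin d → ℝ) ≃ₗ[ℝ] (Fin d → ℝ) := Matrix.toLin'OfInv h2 h1
  let φ := L.toAffineEquiv.trans (AffineEquiv.constVAdd ℝ _ (intVec t))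
  have hφ (b : Fin d → ℤ) : φ (intVec b) = intVec (U *ᵥ b + t) := by
    have : φ (intVec b) = intVec t + U.map c *ᵥ intVec b := by
      simp only [φ, L, AffineEquiv.trans_apply, AffineEquiv.constVAdd_apply, vadd_eq_add]
      rfl
    rw [this, map_mulVec_intVec, hadd, add_comm]
  refine ⟨φ, Subset.antisymm ?_ ?_, hφ⟩
  · rintro _ ⟨_, ⟨b, rfl⟩, rfl⟩
    rw [hφ]
    exact intVec_mem_latticePts _
  · rintro _ ⟨b, rfl⟩
    refine ⟨intVec (U⁻¹ *ᵥ (b - t)), intVec_mem_latticePts _, ?_⟩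
    rw [hφ, Matrix.mulVec_mulVec, Matrix.mul_nonsing_inv U hU, Matrix.one_mulVec, sub_add_cancel]

/-- If the simplex with vertices `f i` has maximal volume among the simplices with vertices
in `B`, every point of `B` has barycentric coordinates of absolute value at most one; here the
coordinates are scaled by the normalized volume of the simplex. -/
theorem exists_barycentric_of_forall_abs_det_le {d : ℕ} {B : Set (Fin d → ℤ)}
    {f : Fin (d + 1) → Fin d → ℤ} (hf : ∀ i, f i ∈ B)
    (hmax : ∀ g : Fin (d + 1) → Fin d → ℤ, (∀ i, g i ∈ B) →
      |(homogMatrix g).det| ≤ |(homogMatrix f).det|) {x : Fin d → ℤ} (hx : x ∈ B) :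
    ∃ μ : Fin (d + 1) → ℤ, (∀ i, μ i ≤ |(homogMatrix f).det|) ∧
      ∑ i, μ i = |(homogMatrix f).det| ∧
      ∑ i, μ i • f i = |(homogMatrix f).det| • x := by
  let y : Fin (d + 1) → ℤ := Fin.cons 1 x
  let ν := Matrix.cramer (homogMatrix f)ᵀ y
  have hν (i : Fin (d + 1)) : |ν i| ≤ |(homogMatrix f).det| := by
    have hupd : (homogMatrix f)ᵀ.updateCol i y = (homogMatrix (Function.update f i x))ᵀ := by
      ext k j
      by_cases hj : j = i
      · subst hj
        simp [homogMatrix, y]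
      · simp [homogMatrix, hj]
    simp only [ν, Matrix.cramer_apply, hupd, Matrix.det_transpose]
    refine hmax _ fun k => ?_
    by_cases hk : k = i
    · subst hk; simpa using hx
    · simpa [hk] using hf k
  have hmul : (homogMatrix f)ᵀ *ᵥ ν = (homogMatrix f).det • y := by
    rw [Matrix.mulVec_cramer, Matrix.det_transpose]
  have hone : ∑ i, ν i = (homogMatrix f).det := by
    have := congrFun hmul 0
    simpa [Matrix.mulVec, dotProduct, homogMatrix, y] using this
  have hcoord (j : Fin d) : ∑ i, ν i * f i j = (homogMatrix f).det * x j := by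
    have := congrFun hmul j.succ
    simpa [Matrix.mulVec, dotProduct, homogMatrix, y, mul_comm] using this
  let ε := ((homogMatrix f).det).sign
  have hε : ε * (homogMatrix f).det = |(homogMatrix f).det| := Int.sign_mul_self_eq_abs _
  refine ⟨fun i => ε * ν i, fun i => ?_, ?_, ?_⟩
  · refine (le_abs_self _).trans ?_
    rw [abs_mul]
    refine (mul_le_of_le_one_left (abs_nonneg _) ?_).trans (hν i)
    rcases Int.sign_trichotomy (homogMatrix f).det with h | h | h <;> simp [ε, h]
  · rw [← Finset.mul_sum, hone, hε]
  · ext j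
    simp only [Finset.sum_apply, Pi.smul_apply, smul_eq_mul, mul_assoc, ← Finset.mul_sum]
    rw [hcoord, ← mul_assoc, hε]

/-- A finite spanning set of lattice points can be moved by a lattice-preserving affine map into
the cube of side `d` times the normalized volume of an inscribed simplex. -/
theorem exists_unimodular_forall_mem_box {d : ℕ} {B : Set (Fin d → ℤ)} (hfin : B.Finite)
    (hB : affineSpan ℝ (intVec '' B) = ⊤) :
    ∃ (f : Fin (d + 1) → Fin d → ℤ) (U : Matrix (Fin d) (Fin d) ℤ) (t : Fin d → ℤ),
      (∀ i, f i ∈ B) ∧ IsUnit U.det ∧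
      ∀ b ∈ B, ∀ j, 0 ≤ (U *ᵥ b + t) j ∧ (U *ᵥ b + t) j ≤ d * |(homogMatrix f).det| := by
  obtain ⟨f₀, hf₀, hdet₀⟩ := exists_det_homogMatrix_ne_zero B hB
  obtain ⟨f, hf, hmax⟩ := Set.exists_max_image {f : Fin (d + 1) → Fin d → ℤ | ∀ i, f i ∈ B}
    (fun f => |(homogMatrix f).det|) (Set.Finite.pi' fun _ => hfin) ⟨f₀, hf₀⟩
  set D := |(homogMatrix f).det| with hD
  have hDpos : 0 < D := (abs_pos.2 hdet₀).trans_le (hmax f₀ hf₀)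
  let N : Matrix (Fin d) (Fin d) ℤ := Matrix.of fun k => f k.succ - f 0
  have hN : |Nᵀ.det| = D := by
    rw [Matrix.det_transpose, hD, det_homogMatrix_eq_det_sub_zero]
  obtain ⟨U, hU, hent⟩ := exists_unimodular_mul_entries_le Nᵀ (abs_pos.1 (hN ▸ hDpos))
  rw [hN] at hent
  let c (i : Fin (d + 1)) : Fin d → ℤ := U *ᵥ (f i - f 0)
  have hc (i : Fin (d + 1)) (j : Fin d) : 0 ≤ c i j ∧ c i j ≤ D := by
    refine Fin.cases ?_ (fun k => ?_) i
    · simpa [c] using hDpos.le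
    · exact hent j k
  refine ⟨f, U, fun j => d * D - ∑ i, c i j - (U *ᵥ f 0) j, hf, hU, fun b hb j => ?_⟩
  obtain ⟨μ, hμle, hμsum, hμ⟩ := exists_barycentric_of_forall_abs_det_le hf hmax hb
  have hval : D * (U *ᵥ b - U *ᵥ f 0) j = ∑ i, μ i * c i j := by
    have h : ∑ i, μ i • c i = D • (U *ᵥ b - U *ᵥ f 0) := by
      simp only [c, ← Matrix.mulVec_smul, ← Matrix.mulVec_sub]
      rw [← Matrix.mulVec_sum]
      simp only [smul_sub, Finset.sum_sub_distrib, ← Finset.sum_smul]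
      rw [hμ, hμsum]
    simpa using (congrFun h j).symm
  have hsub : D * (∑ i, c i j - (U *ᵥ b - U *ᵥ f 0) j) = ∑ i, (D - μ i) * c i j := by
    rw [mul_sub, hval, Finset.mul_sum, ← Finset.sum_sub_distrib]
    exact Finset.sum_congr rfl fun i _ => by ring
  have hlow : 0 ≤ ∑ i, (D - μ i) * c i j :=
    Finset.sum_nonneg fun i _ => mul_nonneg (sub_nonneg.2 (hμle i)) (hc i j).1
  have hupp : ∑ i, (D - μ i) * c i j ≤ D * (d * D) := by
    calc ∑ i, (D - μ i) * c i j ≤ ∑ i, (D - μ i) * D :=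
          Finset.sum_le_sum fun i _ => mul_le_mul_of_nonneg_left (hc i j).2 (sub_nonneg.2 (hμle i))
      _ = D * (d * D) := by
          rw [← Finset.sum_mul, Finset.sum_sub_distrib, hμsum]
          simp
          ring
  rw [← hsub] at hlow hupp
  have h1 := nonneg_of_mul_nonneg_right hlow hDpos
  have h2 := le_of_mul_le_mul_left hupp hDpos
  simp only [Pi.sub_apply, Pi.add_apply] at h1 h2 ⊢
  constructor <;> linarith

theorem exists_int_points_of_isLatticePolytope {d : ℕ} {P : Set (Fin d → ℝ)}
    (hP : IsLatticePolytope P) :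
    ∃ B : Set (Fin d → ℤ), B.Finite ∧ P = convexHull ℝ (intVec '' B) := by
  obtain ⟨A, hA, rfl⟩ := hP
  refine ⟨intVec ⁻¹' A, A.finite_toSet.preimage (intVec_injective d).injOn, ?_⟩
  rw [image_preimage_eq_of_subset hA]

theorem isLatticePolytope_convexHull_intVec_image {d : ℕ} {B : Set (Fin d → ℤ)}
    (hB : B.Finite) : IsLatticePolytope (convexHull ℝ (intVec '' B)) := by
  refine ⟨(hB.image intVec).toFinset, ?_, by simp⟩
  rw [Set.Finite.coe_toFinset]
  exact image_subset_range _ _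

theorem exists_unimodEquiv_subset_cube {d : ℕ} {V : ℝ} {P : Set (Fin d → ℝ)}
    (hP : IsLatticePolytope P) (hdim : IsFullDim P) (hV : vol P ≤ V) :
    ∃ P' : Set (Fin d → ℝ), IsLatticePolytope P' ∧ UnimodEquiv P P' ∧
      P' ⊆ {x : Fin d → ℝ | ∀ i, 0 ≤ x i ∧ x i ≤ (d : ℝ) * (Nat.factorial d : ℝ) * V} := by
  obtain ⟨B, hfin, rfl⟩ := exists_int_points_of_isLatticePolytope hP
  rw [IsFullDim, affineSpan_convexHull] at hdim
  obtain ⟨f, U, t, hf, hU, hbox⟩ := exists_unimodular_forall_mem_box hfin hdim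
  obtain ⟨φ, hφ, hφB⟩ := exists_affineEquiv_intVec U hU t
  have himage : φ '' convexHull ℝ (intVec '' B) =
      convexHull ℝ (intVec '' ((fun b => U *ᵥ b + t) '' B)) := by
    rw [← AffineEquiv.coe_toAffineMap, AffineMap.image_convexHull, image_image, image_image]
    congr 1
    exact image_congr fun b _ => hφB b
  have hvol : (|(homogMatrix f).det| : ℝ) ≤ d.factorial * V := by
    have hfinite : volume (convexHull ℝ (intVec '' B)) ≠ ⊤ :=
      ((hfin.image intVec).isCompact_convexHull (𝕜 := ℝ)).measure_lt_top.ne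
    have hsub : convexHull ℝ (range fun i => intVec (f i)) ⊆ convexHull ℝ (intVec '' B) :=
      convexHull_mono (range_subset_iff.2 fun i => mem_image_of_mem _ (hf i))
    have h := (abs_det_homogMatrix_le_factorial_mul_volume fun i => intVec (f i)).trans
      (mul_le_mul_right (measure_mono hsub) _)
    rw [det_homogMatrix_intVec, ENNReal.ofReal_le_iff_le_toReal
      (ENNReal.mul_ne_top (by simp) hfinite), ENNReal.toReal_mul, ENNReal.toReal_natCast] at h
    exact h.trans (mul_le_mul_of_nonneg_left hV (by positivity))
  refine ⟨_, isLatticePolytope_convexHull_intVec_image (hfin.image fun b => U *ᵥ b + t),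
    ⟨φ, hφ, himage⟩, ?_⟩
  have hcube : {x : Fin d → ℝ | ∀ i, 0 ≤ x i ∧ x i ≤ (d : ℝ) * (Nat.factorial d : ℝ) * V} =
      Icc 0 fun _ => (d : ℝ) * (Nat.factorial d : ℝ) * V := by
    ext x
    simp [Pi.le_def, forall_and]
  rw [hcube]
  refine convexHull_min ?_ (convex_Icc _ _)
  rintro _ ⟨_, ⟨b, hb, rfl⟩, rfl⟩
  refine ⟨fun j => ?_, fun j => ?_⟩
  · exact Int.cast_nonneg (hbox b hb j).1
  · have h : (((U *ᵥ b + t) j : ℤ) : ℝ) ≤ d * |((homogMatrix f).det : ℝ)| := by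
      exact_mod_cast (hbox b hb j).2
    rw [mul_assoc]
    exact h.trans (mul_le_mul_of_nonneg_left hvol (by positivity))

theorem finite_latticePolytopes_subset_cube (d : ℕ) (R : ℝ) :
    {P : Set (Fin d → ℝ) | IsLatticePolytope P ∧
      P ⊆ {x : Fin d → ℝ | ∀ i, 0 ≤ x i ∧ x i ≤ R}}.Finite := by
  have hL : (Icc (0 : Fin d → ℤ) fun _ => ⌊R⌋).Finite := Set.finite_Icc _ _
  refine (hL.finite_subsets.image fun B => convexHull ℝ (intVec '' B)).subset ?_
  rintro P ⟨hP, hPR⟩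
  obtain ⟨B, -, rfl⟩ := exists_int_points_of_isLatticePolytope hP
  refine ⟨B, fun b hb => ?_, rfl⟩
  have h := hPR (subset_convexHull ℝ _ (mem_image_of_mem intVec hb))
  exact ⟨fun i => Int.cast_nonneg_iff.1 (h i).1, fun i => Int.le_floor.2 (h i).2⟩

theorem UnimodEquiv.vol_le {d : ℕ} {P Q : Set (Fin d → ℝ)} (h : UnimodEquiv P Q) :
    vol P ≤ vol Q := by
  obtain ⟨φ, hφ, rfl⟩ := h
  let L : (Fin d → ℝ) →ₗ[ℝ] (Fin d → ℝ) := φ.linear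
  have hlat (b : Fin d → ℤ) : ∃ c : Fin d → ℤ, intVec c = φ (intVec b) := by
    have : φ (intVec b) ∈ latticePts d := hφ ▸ mem_image_of_mem φ (intVec_mem_latticePts b)
    exact this
  choose g hg using hlat
  let M : Matrix (Fin d) (Fin d) ℤ := Matrix.of fun i j => g (Pi.single j 1) i - g 0 i
  have hLφ (x : Fin d → ℝ) : L x = φ x - φ 0 := by
    simpa [L] using φ.toAffineMap.linearMap_vsub x 0
  have hM : LinearMap.toMatrix' L = M.map (Int.castRingHom ℝ) := by
    ext i j
    have h1 : intVec (Pi.single j 1 : Fin d → ℤ) = Pi.single j 1 := by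
      ext k; simp [intVec, Pi.single_apply]
    have h0 : intVec (0 : Fin d → ℤ) = 0 := by ext k; simp [intVec]
    rw [LinearMap.toMatrix'_apply, hLφ, ← h1, ← h0, ← hg, ← hg]
    simp [M, intVec]
  have hdet : LinearMap.det L = (M.det : ℝ) := by
    rw [← LinearMap.det_toMatrix', hM, ← eq_intCast (Int.castRingHom ℝ), RingHom.map_det]
    rfl
  have hne : LinearMap.det L ≠ 0 := (LinearEquiv.isUnit_det' φ.linear).ne_zero
  have hone : 1 ≤ |LinearMap.det L| := by
    rw [hdet] at hne ⊢
    exact_mod_cast Int.one_le_abs (by exact_mod_cast hne)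
  have himage : φ '' P = (fun x => φ 0 + x) '' (L '' P) := by
    rw [image_image]
    exact image_congr fun x _ => by rw [hLφ]; abel
  rw [vol, vol, himage, image_add_left, measure_preimage_add, Measure.addHaar_image_linearMap,
    ENNReal.toReal_mul, ENNReal.toReal_ofReal (abs_nonneg _)]
  exact le_mul_of_one_le_left ENNReal.toReal_nonneg hone

/-- Lagarias–Ziegler: a `d`-dimensional lattice polytope of
volume at most `V` is unimodular equivalent to one inside the cube of side
`d·d!·V`; consequently a family of `d`-dimensional lattice polytopes has
finitely many unimodular classes iff its volumes are bounded. -/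
theorem lagarias_ziegler (d : ℕ) :
    (∀ V : ℝ, 0 < V → ∀ P : Set (Fin d → ℝ),
      IsLatticePolytope P → IsFullDim P → vol P ≤ V →
      ∃ P' : Set (Fin d → ℝ), IsLatticePolytope P' ∧ UnimodEquiv P P' ∧
        P' ⊆ {x : Fin d → ℝ |
          ∀ i, 0 ≤ x i ∧ x i ≤ (d : ℝ) * (Nat.factorial d : ℝ) * V}) ∧
    (∀ (ι : Type) (Ps : ι → Set (Fin d → ℝ)),
      (∀ i, IsLatticePolytope (Ps i) ∧ IsFullDim (Ps i)) →
      ((∃ C : ℝ, ∀ i, vol (Ps i) < C) ↔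
        (∃ (N : ℕ) (Qs : Fin N → Set (Fin d → ℝ)),
          ∀ i, ∃ j, UnimodEquiv (Ps i) (Qs j)))) := by
  refine ⟨fun V _ P hP hdim hV => exists_unimodEquiv_subset_cube hP hdim hV,
    fun ι Ps hPs => ⟨?_, ?_⟩⟩
  · rintro ⟨C, hC⟩
    choose P' hP' hequiv hcube using fun i =>
      exists_unimodEquiv_subset_cube (hPs i).1 (hPs i).2 (hC i).le
    obtain ⟨N, Qs, -, hQs⟩ :=
      (finite_latticePolytopes_subset_cube d ((d : ℝ) * (Nat.factorial d : ℝ) * C)).fin_param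
    refine ⟨N, Qs, fun i => ?_⟩
    obtain ⟨j, hj⟩ : P' i ∈ range Qs := hQs ▸ ⟨hP' i, hcube i⟩
    exact ⟨j, hj ▸ hequiv i⟩
  · rintro ⟨N, Qs, hQs⟩
    refine ⟨∑ j, vol (Qs j) + 1, fun i => ?_⟩
    obtain ⟨j, hj⟩ := hQs i
    exact lt_add_of_le_of_pos (hj.vol_le.trans
      (Finset.single_le_sum (f := fun j => vol (Qs j)) (fun _ _ => ENNReal.toReal_nonneg)
        (Finset.mem_univ j))) one_pos
end
end
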